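/- arXiv:0707.1505 — 2 statements merged into one kernel-verified Lean document; each statement's English description precedes it below -/
import Mathlib

section
/- For every real number γ with 0 < γ < 1, the set 𝒫 = {p a good rational prime : m_p(φ,P) ≥ (log p)^γ} has logarithmic analytic density 1; that is, (s−1)·Σ_{p ∈ 𝒫} (log p)/p^s tends to 1 as s → 1⁺. -/
open MvPolynomial Filter Topology

noncomputable section

/-- The map on integer vectors induced by the homogeneous polynomials `Fp i`. -/
def Fmap {N : ℕ} (Fp : Fin (N + 1) → MvPolynomial (Fin (N + 1)) ℤ) :
    (Fin (N + 1) → ℤ) → (Fin (N + 1) → ℤ) :=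
  fun b i => MvPolynomial.eval b (Fp i)

/-- A rational prime `p` is good if the reductions of the `Fp i` modulo `p` have no common
zero in an algebraic closure of `𝔽_p` other than the origin. -/
def GoodPrime {N : ℕ} (Fp : Fin (N + 1) → MvPolynomial (Fin (N + 1)) ℤ) (p : ℕ) : Prop :=
  ∃ _ : Fact p.Prime,
    ∀ x : Fin (N + 1) → AlgebraicClosure (ZMod p),
      (∀ i, MvPolynomial.aeval x (Fp i) = 0) → x = 0

/-- The number of distinct points of `ℙ^N(𝔽_p)` represented by the reductions mod `p` of the
iterates `F^[n](a)`, i.e. the size of the orbit of `P mod p`. -/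
def orbitLen {N : ℕ} (Fp : Fin (N + 1) → MvPolynomial (Fin (N + 1)) ℤ)
    (a : Fin (N + 1) → ℤ) (p : ℕ) : ℕ :=
  Set.ncard (Set.range fun n : ℕ =>
    Quotient.mk (MulAction.orbitRel (ZMod p)ˣ (Fin (N + 1) → ZMod p))
      (fun i => (((Fmap Fp)^[n] a) i : ZMod p)))

open ArithmeticFunction ArithmeticFunction.vonMangoldt in
lemma aux_H {x : ℝ} (hx : 1 < x) :
    ∑' n : ℕ, ArithmeticFunction.vonMangoldt n / (n : ℝ) ^ x =
      (LFunctionResidueClassAux (1 : ZMod 1) x).re + 1 / (x - 1) := by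
  have hr : ∀ n : ℕ, residueClass (1 : ZMod 1) n = ArithmeticFunction.vonMangoldt n := by
    intro n
    simp only [residueClass]
    rw [Set.indicator_of_mem]
    exact Subsingleton.elim (α := ZMod 1) _ _
  simp_rw [← hr]
  have ha : IsUnit (1 : ZMod 1) := isUnit_one
  refine Complex.ofReal_injective ?_
  have h2 := eqOn_LFunctionResidueClassAux ha (x := (x : ℂ)) (by simpa using hx)
  simp only [Complex.ofReal_tsum, Complex.ofReal_div, Complex.ofReal_cpow (Nat.cast_nonneg _),
    Complex.ofReal_natCast, Complex.ofReal_add, Complex.ofReal_sub, Complex.ofReal_one]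
  rw [← LFunctionResidueClassAux_real ha hx, h2]
  simp only [Nat.totient_one, Nat.cast_one, inv_one, sub_add_cancel, LSeries, LSeries.term]
  refine tsum_congr fun n ↦ ?_
  split_ifs with hn
  · simp [hn]
  · rfl

open ArithmeticFunction ArithmeticFunction.vonMangoldt in
lemma aux_A0 : Tendsto (fun s : ℝ => (s - 1) *
    ∑' n : ℕ, ArithmeticFunction.vonMangoldt n / (n : ℝ) ^ s) (𝓝[>] (1 : ℝ)) (𝓝 1) := by
  have hc : ContinuousOn (fun x : ℝ ↦ (LFunctionResidueClassAux (1 : ZMod 1) x).re) (Set.Ici 1) :=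
    Complex.continuous_re.continuousOn.comp (t := Set.univ)
      (continuousOn_LFunctionResidueClassAux (1 : ZMod 1))
      (fun ⦃x⦄ a ↦ trivial) |>.comp Complex.continuous_ofReal.continuousOn fun x hx ↦ by
        simpa using hx
  have h1 : Tendsto (fun x : ℝ ↦ (LFunctionResidueClassAux (1 : ZMod 1) x).re) (𝓝[>] (1 : ℝ))
      (𝓝 (LFunctionResidueClassAux (1 : ZMod 1) (1 : ℝ)).re) :=
    (hc 1 (by simp)).mono_left (nhdsWithin_mono _ Set.Ioi_subset_Ici_self)
  have h2 : Tendsto (fun x : ℝ ↦ x - 1) (𝓝[>] (1 : ℝ)) (𝓝 0) := by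
    have : Tendsto (fun x : ℝ ↦ x - 1) (𝓝 (1 : ℝ)) (𝓝 (1 - 1)) := tendsto_id.sub_const 1
    rw [sub_self] at this
    exact this.mono_left nhdsWithin_le_nhds
  have h3 := (h2.mul h1).add_const 1
  rw [zero_mul, zero_add] at h3
  refine h3.congr' ?_
  filter_upwards [self_mem_nhdsWithin] with x hx
  have hx' : x - 1 ≠ 0 := sub_ne_zero.2 (ne_of_gt hx)
  rw [aux_H hx]
  field_simp

open ArithmeticFunction ArithmeticFunction.vonMangoldt in
lemma aux_np : Summable fun n : ℕ ↦ (if n.Prime then 0 else ArithmeticFunction.vonMangoldt n) / (n : ℝ) := by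
  have := summable_residueClass_non_primes_div (1 : ZMod 1)
  refine this.congr fun n => ?_
  have : residueClass (1 : ZMod 1) n = ArithmeticFunction.vonMangoldt n := by
    simp only [residueClass]
    rw [Set.indicator_of_mem]
    exact Subsingleton.elim (α := ZMod 1) _ _
  rw [this]

lemma aux_summ {x : ℝ} (hx : 1 < x) :
    Summable fun n : ℕ => ArithmeticFunction.vonMangoldt n / (n : ℝ) ^ x := by
  have h := ArithmeticFunction.LSeriesSummable_vonMangoldt (s := (x : ℂ)) (by simpa using hx)
  unfold LSeriesSummable at h
  have h := h.norm
  refine h.congr fun n => ?_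
  rw [LSeries.norm_term_eq]
  split_ifs with hn
  · simp [hn]
  · simp [abs_of_nonneg ArithmeticFunction.vonMangoldt_nonneg]

lemma aux_A (Q : Set ℕ) (hQ : ∀ p ∈ Q, p.Prime)
    (hs : Summable ({p : ℕ | p.Prime ∧ p ∉ Q}.indicator fun p : ℕ => Real.log p / p)) :
    Tendsto (fun s : ℝ => (s - 1) * ∑' p : Q, Real.log (p : ℕ) / ((p : ℕ) : ℝ) ^ s)
      (𝓝[>] (1 : ℝ)) (𝓝 1) := by
  classical
  set R : ℕ → ℝ := fun n => ArithmeticFunction.vonMangoldt n - Q.indicator (fun n : ℕ => Real.log n) n with hR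
  have hRe : ∀ n, R n / n = (if n.Prime then 0 else ArithmeticFunction.vonMangoldt n) / (n : ℝ) +
      ({p : ℕ | p.Prime ∧ p ∉ Q}.indicator fun p : ℕ => Real.log p / p) n := by
    intro n
    simp only [hR, Set.indicator_apply, Set.mem_ofPred_eq]
    by_cases h1 : n.Prime
    · by_cases h2 : n ∈ Q <;> simp [h1, h2, ArithmeticFunction.vonMangoldt_apply_prime h1]
    · have h2 : n ∉ Q := fun h => h1 (hQ n h)
      simp [h1, h2]
  have hR0 : ∀ n, 0 ≤ R n := by
    intro n
    simp only [hR, Set.indicator_apply]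
    split_ifs with h
    · rw [ArithmeticFunction.vonMangoldt_apply_prime (hQ n h), sub_self]
    · rw [sub_zero]; exact ArithmeticFunction.vonMangoldt_nonneg
  have hRs : Summable fun n : ℕ => R n / n := by
    simp_rw [hRe]
    exact aux_np.add hs
  have hle : ∀ s : ℝ, 1 < s → ∀ n : ℕ, R n / (n : ℝ) ^ s ≤ R n / n := by
    intro s hs n
    rcases Nat.eq_zero_or_pos n with rfl | hn
    · rw [Nat.cast_zero, Real.zero_rpow (by linarith)]
    · have h1 : (1 : ℝ) ≤ n := by exact_mod_cast hn
      apply div_le_div_of_nonneg_left (hR0 n) (by linarith)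
      calc (n : ℝ) = (n : ℝ) ^ (1 : ℝ) := (Real.rpow_one _).symm
        _ ≤ _ := Real.rpow_le_rpow_of_exponent_le h1 hs.le
  have hRss : ∀ s : ℝ, 1 < s → Summable fun n : ℕ => R n / (n : ℝ) ^ s := fun s hs =>
    hRs.of_nonneg_of_le (fun n => div_nonneg (hR0 n) (by positivity)) (hle s hs)
  have h0 : Tendsto (fun s : ℝ => (s - 1) * ∑' n : ℕ, R n / (n : ℝ) ^ s) (𝓝[>] (1 : ℝ)) (𝓝 0) := by
    have h2 : Tendsto (fun x : ℝ ↦ (x - 1) * ∑' n : ℕ, R n / n) (𝓝[>] (1 : ℝ)) (𝓝 0) := by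
      have : Tendsto (fun x : ℝ ↦ (x - 1) * ∑' n : ℕ, R n / n) (𝓝 (1 : ℝ))
        (𝓝 ((1 - 1) * ∑' n : ℕ, R n / n)) := (tendsto_id.sub_const 1).mul_const _
      rw [sub_self, zero_mul] at this
      exact this.mono_left nhdsWithin_le_nhds
    refine tendsto_of_tendsto_of_tendsto_of_le_of_le' tendsto_const_nhds h2 ?_ ?_
    · filter_upwards [self_mem_nhdsWithin] with s hs
      have : (1 : ℝ) < s := hs
      exact mul_nonneg (by linarith) (tsum_nonneg fun n => div_nonneg (hR0 n) (by positivity))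
    · filter_upwards [self_mem_nhdsWithin] with s hs
      have : (1 : ℝ) < s := hs
      exact mul_le_mul_of_nonneg_left ((hRss s hs).tsum_le_tsum (hle s hs) hRs) (by linarith)
  have h1 := aux_A0.sub h0
  rw [sub_zero] at h1
  refine h1.congr' ?_
  filter_upwards [self_mem_nhdsWithin] with s hs
  rw [← mul_sub, ← (aux_summ hs).tsum_sub (hRss s hs),
    tsum_subtype Q (fun p : ℕ => Real.log p / (p : ℝ) ^ s)]
  congr 1
  refine tsum_congr fun n => ?_
  rw [← sub_div]
  simp only [hR, Set.indicator_apply]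
  split_ifs <;> simp

lemma aux_B {N : ℕ} (Fp : Fin (N + 1) → MvPolynomial (Fin (N + 1)) ℤ)
    (hzero : ∀ x : Fin (N + 1) → AlgebraicClosure ℚ,
      (∀ i, MvPolynomial.aeval x (Fp i) = 0) → x = 0) :
    {p : ℕ | p.Prime ∧ ¬ GoodPrime Fp p}.Finite := by
  classical
  have key : ∀ j : Fin (N + 1), ∃ (D : ℤ) (k : ℕ) (G : Fin (N + 1) → MvPolynomial (Fin (N + 1)) ℤ),
      D ≠ 0 ∧ C D * X j ^ k = ∑ i, G i * Fp i := by
    intro j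
    let I : Ideal (MvPolynomial (Fin (N + 1)) ℚ) :=
      Ideal.span (Set.range fun i => map (Int.castRingHom ℚ) (Fp i))
    have hj : (X j : MvPolynomial (Fin (N + 1)) ℚ) ∈ I.radical := by
      rw [← vanishingIdeal_zeroLocus_eq_radical (K := AlgebraicClosure ℚ)]
      rw [mem_vanishingIdeal_iff]
      intro x hx
      have : x = 0 := by
        apply hzero
        intro i
        have := hx _ (Ideal.subset_span (Set.mem_range_self i))
        rwa [show Int.castRingHom ℚ = algebraMap ℤ ℚ from rfl, aeval_map_algebraMap] at this
      simp [this]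
    obtain ⟨k, hk⟩ := hj
    rw [Ideal.mem_span_range_iff_exists_fun] at hk
    obtain ⟨c, hc⟩ := hk
    letI := algebraMvPolynomial (σ := Fin (N + 1)) (R := ℤ) (S := ℚ)
    obtain ⟨⟨b, hb⟩, hbi⟩ := IsLocalization.exist_integer_multiples_of_finite
      ((nonZeroDivisors ℤ).map (C (σ := Fin (N + 1)))) (S := MvPolynomial (Fin (N + 1)) ℚ) c
    obtain ⟨D, hD, rfl⟩ := hb
    choose G hG using hbi
    refine ⟨D, k, G, nonZeroDivisors.ne_zero hD, ?_⟩
    apply map_injective (Int.castRingHom ℚ) Int.cast_injective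
    have hG' : ∀ i, map (Int.castRingHom ℚ) (G i) = C (D : ℚ) * c i := by
      intro i
      have := hG i
      simp only [Algebra.smul_def, algebraMap_def] at this
      simpa using this
    simp only [map_mul, map_sum, map_pow, map_C, map_X, hG']
    rw [← hc, Finset.mul_sum]
    simp [mul_assoc]
  choose D k G hD hG using key
  have hfin : {p : ℕ | p ∣ (∏ j, D j).natAbs}.Finite := by
    refine (Nat.divisors (∏ j, D j).natAbs).finite_toSet.subset ?_
    intro p hp
    have : (∏ j, D j).natAbs ≠ 0 := by
      simp [Finset.prod_eq_zero_iff, hD]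
    simpa [this, Finset.prod_eq_zero_iff, hD] using hp
  refine hfin.subset ?_
  rintro p ⟨hp, hng⟩
  by_contra hdvd
  apply hng
  haveI : Fact p.Prime := ⟨hp⟩
  refine ⟨⟨hp⟩, fun x hx => ?_⟩
  funext j
  have h := congrArg (aeval x) (hG j)
  simp only [map_mul, map_sum, map_pow, aeval_X, hx, mul_zero, Finset.sum_const_zero,
    algHom_C] at h
  rcases mul_eq_zero.1 h with h | h
  · exfalso
    apply hdvd
    have h' : ((D j : ℤ) : AlgebraicClosure (ZMod p)) = 0 := by simpa using h
    rw [CharP.intCast_eq_zero_iff _ p] at h'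
    have := h'.trans (Finset.dvd_prod_of_mem D (Finset.mem_univ j))
    exact Int.natCast_dvd.1 this
  · exact eq_zero_of_pow_eq_zero h

lemma aux_C1 {N d : ℕ} (Fp : Fin (N + 1) → MvPolynomial (Fin (N + 1)) ℤ)
    (hhom : ∀ i, (Fp i).IsHomogeneous d) :
    ∃ A : ℝ, 1 ≤ A ∧ ∀ (B : ℝ) (b : Fin (N + 1) → ℤ), 1 ≤ B → (∀ i, |(b i : ℝ)| ≤ B) →
      ∀ i, |((Fmap Fp b i : ℤ) : ℝ)| ≤ A * B ^ d := by
  refine ⟨1 + ∑ i, ∑ e ∈ (Fp i).support, |(((Fp i).coeff e : ℤ) : ℝ)|, ?_, ?_⟩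
  · have : 0 ≤ ∑ i, ∑ e ∈ (Fp i).support, |(((Fp i).coeff e : ℤ) : ℝ)| := by positivity
    linarith
  intro B b hB hb i
  have h1 : |((Fmap Fp b i : ℤ) : ℝ)| ≤ (∑ e ∈ (Fp i).support, |(((Fp i).coeff e : ℤ) : ℝ)|) * B ^ d := by
    rw [Fmap, eval_eq']
    push_cast
    refine (Finset.abs_sum_le_sum_abs _ _).trans ?_
    rw [Finset.sum_mul]
    refine Finset.sum_le_sum fun e he => ?_
    rw [abs_mul, Finset.abs_prod]
    refine mul_le_mul_of_nonneg_left ?_ (abs_nonneg _)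
    calc ∏ j, |(b j : ℝ) ^ e j| ≤ ∏ j, B ^ e j := by
          refine Finset.prod_le_prod (fun _ _ => abs_nonneg _) fun j _ => ?_
          rw [abs_pow]
          exact pow_le_pow_left₀ (abs_nonneg _) (hb j) _
      _ = B ^ (∑ j, e j) := Finset.prod_pow_eq_pow_sum _ _ _
      _ ≤ B ^ d := by
          refine pow_le_pow_right₀ hB ?_
          have := (le_totalDegree he).trans (hhom i).totalDegree_le
          rwa [Finsupp.sum_fintype _ _ (fun _ => rfl)] at this
  refine h1.trans (mul_le_mul_of_nonneg_right ?_ (by positivity))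
  have := Finset.single_le_sum (f := fun i => ∑ e ∈ (Fp i).support, |(((Fp i).coeff e : ℤ) : ℝ)|)
    (fun _ _ => by positivity) (Finset.mem_univ i)
  linarith

lemma aux_C2 {N d : ℕ} (hd : 2 ≤ d) (Fp : Fin (N + 1) → MvPolynomial (Fin (N + 1)) ℤ)
    (hhom : ∀ i, (Fp i).IsHomogeneous d) (a : Fin (N + 1) → ℤ) :
    ∃ c : ℝ, 0 ≤ c ∧ ∀ n i, |((((Fmap Fp)^[n] a) i : ℤ) : ℝ)| ≤ Real.exp (c * d ^ n) := by
  obtain ⟨A, hA, h⟩ := aux_C1 Fp hhom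
  have hL : 0 ≤ Real.log A := Real.log_nonneg hA
  set H : ℝ := 1 + ∑ i, |(a i : ℝ)| with hH
  have hH1 : 1 ≤ H := by
    have : 0 ≤ ∑ i, |(a i : ℝ)| := by positivity
    linarith
  have hh : 0 ≤ Real.log H := Real.log_nonneg hH1
  have hd' : (2 : ℝ) ≤ d := by exact_mod_cast hd
  refine ⟨Real.log H + Real.log A, by positivity, ?_⟩
  have key : ∀ n i, |((((Fmap Fp)^[n] a) i : ℤ) : ℝ)| ≤
      Real.exp ((Real.log H + Real.log A) * d ^ n - Real.log A) := by
    intro n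
    induction n with
    | zero =>
      intro i
      simp only [Function.iterate_zero, id_eq, pow_zero, mul_one, add_sub_cancel_right]
      rw [Real.exp_log (by linarith)]
      have := Finset.single_le_sum (f := fun i => |(a i : ℝ)|)
        (fun _ _ => by positivity) (Finset.mem_univ i)
      linarith
    | succ n ih =>
      intro i
      rw [Function.iterate_succ_apply']
      have h1 : 0 ≤ (Real.log H + Real.log A) * d ^ n - Real.log A := by
        have : (1 : ℝ) ≤ d ^ n := one_le_pow₀ (by linarith)
        nlinarith
      refine (h _ _ (Real.one_le_exp h1) ih i).trans ?_
      rw [← Real.exp_nat_mul]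
      nth_rw 1 [← Real.exp_log (show 0 < A by linarith)]
      rw [← Real.exp_add]
      apply Real.exp_le_exp.2
      rw [pow_succ]
      nlinarith
  intro n i
  refine (key n i).trans (Real.exp_le_exp.2 (by linarith))

lemma aux_D1 {N : ℕ} (Fp : Fin (N + 1) → MvPolynomial (Fin (N + 1)) ℤ)
    (a : Fin (N + 1) → ℤ) (p m : ℕ) (hp : p.Prime) (hm : orbitLen Fp a p ≤ m) :
    ∃ k n : ℕ, k < n ∧ n ≤ m ∧ ∀ i j, (p : ℤ) ∣
      ((Fmap Fp)^[k] a) i * ((Fmap Fp)^[n] a) j - ((Fmap Fp)^[k] a) j * ((Fmap Fp)^[n] a) i := by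
  classical
  haveI : Fact p.Prime := ⟨hp⟩
  set q : ℕ → Quotient (MulAction.orbitRel (ZMod p)ˣ (Fin (N + 1) → ZMod p)) := fun n : ℕ =>
    Quotient.mk (MulAction.orbitRel (ZMod p)ˣ (Fin (N + 1) → ZMod p))
      (fun i => (((Fmap Fp)^[n] a) i : ZMod p)) with hq
  haveI : Finite (Quotient (MulAction.orbitRel (ZMod p)ˣ (Fin (N + 1) → ZMod p))) :=
    Quotient.finite _
  have hfin : (Set.range q).Finite := Set.toFinite _
  have hcard : hfin.toFinset.card < (Finset.range (m + 1)).card := by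
    rw [← Set.ncard_eq_toFinset_card _ hfin, Finset.card_range]
    exact Nat.lt_succ_of_le hm
  obtain ⟨x, hx, y, hy, hxy, he⟩ := Finset.exists_ne_map_eq_of_card_lt_of_maps_to
    (f := q) hcard (fun n _ => by simp)
  have main : ∀ x y, q x = q y → ∀ i j, (p : ℤ) ∣
      ((Fmap Fp)^[x] a) i * ((Fmap Fp)^[y] a) j - ((Fmap Fp)^[x] a) j * ((Fmap Fp)^[y] a) i := by
    intro x y he i j
    have h := Quotient.exact he
    obtain ⟨u, hu⟩ := h
    have hu' : ∀ i, (u : ZMod p) * (((Fmap Fp)^[y] a) i : ZMod p) = (((Fmap Fp)^[x] a) i : ZMod p) :=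
      fun i => congrFun hu i
    rw [← ZMod.intCast_zmod_eq_zero_iff_dvd]
    push_cast
    rw [← hu' i, ← hu' j]
    ring
  simp only [Finset.mem_range] at hx hy
  rcases lt_or_gt_of_ne hxy with h | h
  · exact ⟨x, y, h, by omega, main x y he⟩
  · exact ⟨y, x, h, by omega, main y x he.symm⟩

lemma aux_D {N d : ℕ} (hd : 2 ≤ d) (Fp : Fin (N + 1) → MvPolynomial (Fin (N + 1)) ℤ)
    (hhom : ∀ i, (Fp i).IsHomogeneous d) (a : Fin (N + 1) → ℤ)
    (horbit : ∀ m n : ℕ, m < n → ∃ i j : Fin (N + 1),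
      ((Fmap Fp)^[m] a) i * ((Fmap Fp)^[n] a) j ≠ ((Fmap Fp)^[m] a) j * ((Fmap Fp)^[n] a) i) :
    ∃ c : ℝ, 0 ≤ c ∧ ∀ (m : ℕ) (S : Finset ℕ), (∀ p ∈ S, p.Prime ∧ orbitLen Fp a p ≤ m) →
      ∑ p ∈ S, Real.log p ≤ c * (4 * d) ^ m := by
  obtain ⟨c, hc, hb⟩ := aux_C2 hd Fp hhom a
  choose! I J hIJ using horbit
  set M : ℕ → ℕ → ℕ := fun k n => (((Fmap Fp)^[k] a) (I k n) * ((Fmap Fp)^[n] a) (J k n) -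
    ((Fmap Fp)^[k] a) (J k n) * ((Fmap Fp)^[n] a) (I k n)).natAbs with hM
  have hM0 : ∀ k n, k < n → M k n ≠ 0 := by
    intro k n hkn
    simp only [hM, ne_eq, Int.natAbs_eq_zero, sub_eq_zero]
    exact hIJ k n hkn
  have hd1 : (1 : ℝ) ≤ d := by exact_mod_cast (by omega : 1 ≤ d)
  have hMb : ∀ m k n, k < n → n ≤ m → Real.log (M k n) ≤ (1 + 2 * c) * d ^ m := by
    intro m k n hkn hnm
    have hpos : (0 : ℝ) < M k n := by
      exact_mod_cast Nat.pos_of_ne_zero (hM0 k n hkn)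
    rw [Real.log_le_iff_le_exp hpos]
    have hE : ∀ l i, l ≤ m → |((((Fmap Fp)^[l] a) i : ℤ) : ℝ)| ≤ Real.exp (c * d ^ m) := fun l i hl =>
      (hb l i).trans (Real.exp_le_exp.2 (mul_le_mul_of_nonneg_left (pow_le_pow_right₀ hd1 hl) hc))
    have h1 : (M k n : ℝ) ≤ 2 * (Real.exp (c * d ^ m) * Real.exp (c * d ^ m)) := by
      simp only [hM]
      rw [Nat.cast_natAbs]
      push_cast
      refine (abs_sub _ _).trans ?_
      rw [abs_mul, abs_mul, two_mul]
      have e := (Real.exp_pos (c * d ^ m)).le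
      exact add_le_add (mul_le_mul (hE _ _ (by omega)) (hE _ _ (by omega)) (abs_nonneg _) e)
        (mul_le_mul (hE _ _ (by omega)) (hE _ _ (by omega)) (abs_nonneg _) e)
    refine h1.trans ?_
    have h2 : (2 : ℝ) ≤ Real.exp (d ^ m) := by
      have := Real.add_one_le_exp ((d : ℝ) ^ m)
      have : (1 : ℝ) ≤ d ^ m := one_le_pow₀ hd1
      linarith
    calc 2 * (Real.exp (c * d ^ m) * Real.exp (c * d ^ m))
        ≤ Real.exp (d ^ m) * (Real.exp (c * d ^ m) * Real.exp (c * d ^ m)) :=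
          mul_le_mul_of_nonneg_right h2 (by positivity)
      _ = _ := by rw [← Real.exp_add, ← Real.exp_add]; congr 1; ring
  refine ⟨1 + 2 * c, by positivity, fun m S hS => ?_⟩
  set T : Finset (ℕ × ℕ) :=
    (Finset.range (m + 1) ×ˢ Finset.range (m + 1)).filter (fun x => x.1 < x.2) with hT
  have hTm : ∀ x ∈ T, x.1 < x.2 ∧ x.2 ≤ m := by
    intro x hx
    simp only [hT, Finset.mem_filter, Finset.mem_product, Finset.mem_range] at hx
    exact ⟨hx.2, by omega⟩
  have hprod0 : ∏ x ∈ T, M x.1 x.2 ≠ 0 := Finset.prod_ne_zero_iff.2 fun x hx => hM0 _ _ (hTm x hx).1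
  have hdvd : ∏ p ∈ S, p ∣ ∏ x ∈ T, M x.1 x.2 := by
    refine Finset.prod_primes_dvd _ (fun p hp => (hS p hp).1.prime) fun p hp => ?_
    obtain ⟨k, n, hkn, hnm, hdiv⟩ := aux_D1 Fp a p m (hS p hp).1 (hS p hp).2
    have : p ∣ M k n := Int.natCast_dvd.1 (hdiv (I k n) (J k n))
    refine this.trans (Finset.dvd_prod_of_mem (fun x : ℕ × ℕ => M x.1 x.2) (a := (k, n)) ?_)
    simp only [hT, Finset.mem_filter, Finset.mem_product, Finset.mem_range]
    omega
  calc ∑ p ∈ S, Real.log p = Real.log ((∏ p ∈ S, p : ℕ) : ℝ) := by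
        push_cast
        rw [Real.log_prod]
        intro p hp
        exact_mod_cast (hS p hp).1.ne_zero
    _ ≤ Real.log ((∏ x ∈ T, M x.1 x.2 : ℕ) : ℝ) := by
        apply Real.log_le_log
        · exact_mod_cast Finset.prod_pos fun p hp => (hS p hp).1.pos
        · exact_mod_cast Nat.le_of_dvd (Nat.pos_of_ne_zero hprod0) hdvd
    _ = ∑ x ∈ T, Real.log (M x.1 x.2) := by
        push_cast
        rw [Real.log_prod]
        intro x hx
        exact_mod_cast hM0 _ _ (hTm x hx).1
    _ ≤ ∑ x ∈ T, (1 + 2 * c) * d ^ m :=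
        Finset.sum_le_sum fun x hx => hMb m _ _ (hTm x hx).1 (hTm x hx).2
    _ = T.card * ((1 + 2 * c) * d ^ m) := by rw [Finset.sum_const, nsmul_eq_mul]
    _ ≤ 4 ^ m * ((1 + 2 * c) * d ^ m) := by
        refine mul_le_mul_of_nonneg_right ?_ (by positivity)
        have h1 : T.card ≤ (m + 1) * (m + 1) := by
          refine (Finset.card_filter_le _ _).trans ?_
          simp
        have h2 : m + 1 ≤ 2 ^ m := Nat.lt_two_pow_self
        have h3 : T.card ≤ 4 ^ m := by
          refine h1.trans ((Nat.mul_le_mul h2 h2).trans ?_)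
          rw [← mul_pow]
          norm_num
        exact_mod_cast h3
    _ = _ := by rw [mul_pow]; ring

lemma aux_E0 (K : ℝ) (hK : 1 ≤ K) (γ : ℝ) (hγ0 : 0 < γ) (hγ1 : γ < 1) :
    Summable fun m : ℕ => K ^ m * Real.exp (-((m : ℝ) ^ (1 / γ))) := by
  have hg : 0 < 1 / γ - 1 := by
    rw [sub_pos, lt_div_iff₀ hγ0]; linarith
  have h1 : Tendsto (fun m : ℕ => (m : ℝ) ^ (1 / γ - 1)) atTop atTop :=
    (tendsto_rpow_atTop hg).comp tendsto_natCast_atTop_atTop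
  refine Summable.of_norm_bounded_eventually_nat (g := fun m : ℕ => (1 / 2 : ℝ) ^ m)
    summable_geometric_two ?_
  filter_upwards [h1.eventually_ge_atTop (Real.log (2 * K)), eventually_gt_atTop 0] with m hm hm0
  have hm0' : (0 : ℝ) < m := by exact_mod_cast hm0
  rw [Real.norm_of_nonneg (by positivity)]
  have h2 : (m : ℝ) * Real.log (2 * K) ≤ (m : ℝ) ^ (1 / γ) := by
    calc (m : ℝ) * Real.log (2 * K) ≤ m * (m : ℝ) ^ (1 / γ - 1) :=
          mul_le_mul_of_nonneg_left hm hm0'.le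
      _ = (m : ℝ) ^ (1 / γ) := by
          rw [Real.rpow_sub_one hm0'.ne']; field_simp
  calc K ^ m * Real.exp (-((m : ℝ) ^ (1 / γ))) ≤ K ^ m * Real.exp (-(m * Real.log (2 * K))) := by
        gcongr
    _ = (1 / 2) ^ m := by
        rw [Real.exp_neg, Real.exp_nat_mul, Real.exp_log (by positivity), mul_pow]
        rw [div_pow, one_pow]
        field_simp

lemma aux_E (l : ℕ → ℕ) (K c : ℝ) (hK : 1 ≤ K) (γ : ℝ) (hγ0 : 0 < γ) (hγ1 : γ < 1)
    (h : ∀ (m : ℕ) (S : Finset ℕ), (∀ p ∈ S, p.Prime ∧ l p ≤ m) →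
      ∑ p ∈ S, Real.log p ≤ c * K ^ m) (hc : 0 ≤ c) :
    Summable ({p : ℕ | p.Prime ∧ (l p : ℝ) < Real.log p ^ γ}.indicator
      fun p : ℕ => Real.log p / p) := by
  classical
  have hs := (aux_E0 K hK γ hγ0 hγ1).mul_left c
  refine summable_of_sum_le (c := ∑' m : ℕ, c * (K ^ m * Real.exp (-((m : ℝ) ^ (1 / γ))))) ?_ ?_
  · intro p
    exact Set.indicator_nonneg (fun p _ => div_nonneg (Real.log_natCast_nonneg p) (by positivity)) p
  intro u
  simp only [Set.indicator_apply]
  rw [← Finset.sum_filter]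
  set v := u.filter (fun p => p ∈ {p : ℕ | p.Prime ∧ (l p : ℝ) < Real.log p ^ γ}) with hv
  have hvm : ∀ p ∈ v, p.Prime ∧ (l p : ℝ) < Real.log p ^ γ := fun p hp => (Finset.mem_filter.1 hp).2
  rw [← Finset.sum_fiberwise_of_maps_to (g := l) (t := v.image l)
    (fun p hp => Finset.mem_image_of_mem l hp)]
  refine le_trans (Finset.sum_le_sum (g := fun m : ℕ => c * (K ^ m * Real.exp (-((m : ℝ) ^ (1 / γ)))))
    fun m _ => ?_) (hs.sum_le_tsum _ fun m _ => by positivity)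
  calc ∑ p ∈ v with l p = m, Real.log p / p
      ≤ ∑ p ∈ v with l p = m, Real.log p * Real.exp (-((m : ℝ) ^ (1 / γ))) := by
        refine Finset.sum_le_sum fun p hp => ?_
        rw [Finset.mem_filter] at hp
        obtain ⟨hp, rfl⟩ := hp
        obtain ⟨hpp, hlt⟩ := hvm p hp
        have hp0 : (0 : ℝ) < p := by exact_mod_cast hpp.pos
        have hlog : 0 ≤ Real.log p := Real.log_natCast_nonneg p
        rw [div_eq_mul_inv]
        refine mul_le_mul_of_nonneg_left ?_ hlog
        have he : ((p : ℝ))⁻¹ = Real.exp (-Real.log p) := by rw [Real.exp_neg, Real.exp_log hp0]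
        rw [he]
        apply Real.exp_le_exp.2
        rw [neg_le_neg_iff]
        calc (l p : ℝ) ^ (1 / γ) ≤ (Real.log p ^ γ) ^ (1 / γ) :=
              Real.rpow_le_rpow (by positivity) hlt.le (by positivity)
          _ = Real.log p := by
              rw [← Real.rpow_mul hlog, mul_one_div_cancel hγ0.ne', Real.rpow_one]
    _ = (∑ p ∈ v with l p = m, Real.log p) * Real.exp (-((m : ℝ) ^ (1 / γ))) := by
        rw [Finset.sum_mul]
    _ ≤ (c * K ^ m) * Real.exp (-((m : ℝ) ^ (1 / γ))) := by
        refine mul_le_mul_of_nonneg_right (h m _ fun p hp => ?_) (Real.exp_pos _).le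
        rw [Finset.mem_filter] at hp
        exact ⟨(hvm p hp.1).1, hp.2.le⟩
    _ = _ := by ring

theorem stmt0 (N d : ℕ) (hN : 1 ≤ N) (hd : 2 ≤ d)
    (Fp : Fin (N + 1) → MvPolynomial (Fin (N + 1)) ℤ)
    (hhom : ∀ i, (Fp i).IsHomogeneous d)
    (hzero : ∀ x : Fin (N + 1) → AlgebraicClosure ℚ,
      (∀ i, MvPolynomial.aeval x (Fp i) = 0) → x = 0)
    (a : Fin (N + 1) → ℤ)
    (hcop : Finset.univ.gcd a = 1)
    (horbit : ∀ m n : ℕ, m < n → ∃ i j : Fin (N + 1),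
      ((Fmap Fp)^[m] a) i * ((Fmap Fp)^[n] a) j ≠ ((Fmap Fp)^[m] a) j * ((Fmap Fp)^[n] a) i)
    (γ : ℝ) (hγ0 : 0 < γ) (hγ1 : γ < 1) :
    Tendsto (fun s : ℝ => (s - 1) *
        ∑' p : {p : ℕ // GoodPrime Fp p ∧ Real.log p ^ γ ≤ (orbitLen Fp a p : ℝ)},
          Real.log p.1 / (p.1 : ℝ) ^ s)
      (𝓝[>] (1 : ℝ)) (𝓝 1) := by
  obtain ⟨c, hc, h⟩ := aux_D hd Fp hhom a horbit
  have hK : (1 : ℝ) ≤ 4 * d := by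
    have : (2 : ℝ) ≤ d := by exact_mod_cast hd
    linarith
  have hE := aux_E (orbitLen Fp a) (4 * d) c hK γ hγ0 hγ1 h hc
  have hfin := aux_B Fp hzero
  have hF : Summable ({p : ℕ | p.Prime ∧ ¬ GoodPrime Fp p}.indicator
      fun p : ℕ => Real.log p / p) :=
    summable_of_hasFiniteSupport (hfin.subset Set.support_indicator_subset)
  refine aux_A {p : ℕ | GoodPrime Fp p ∧ Real.log p ^ γ ≤ (orbitLen Fp a p : ℝ)}
    (fun p hp => hp.1.1.out) ?_
  have hnn : ∀ p : ℕ, 0 ≤ Real.log p / p := fun p =>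
    div_nonneg (Real.log_natCast_nonneg p) (by positivity)
  refine (hE.add hF).of_nonneg_of_le (fun p => Set.indicator_nonneg (fun p _ => hnn p) p) fun p => ?_
  by_cases hp : p ∈ {p : ℕ | p.Prime ∧
      p ∉ {p : ℕ | GoodPrime Fp p ∧ Real.log p ^ γ ≤ (orbitLen Fp a p : ℝ)}}
  · rw [Set.indicator_of_mem hp]
    obtain ⟨hp1, hp2⟩ := hp
    by_cases hg : GoodPrime Fp p
    · have hlt : (orbitLen Fp a p : ℝ) < Real.log p ^ γ := by
        by_contra hcon
        exact hp2 ⟨hg, not_lt.1 hcon⟩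
      rw [Set.indicator_of_mem (s := {p : ℕ | p.Prime ∧ (orbitLen Fp a p : ℝ) < Real.log p ^ γ})
        ⟨hp1, hlt⟩]
      exact le_add_of_nonneg_right (Set.indicator_nonneg (fun p _ => hnn p) p)
    · rw [Set.indicator_of_mem (s := {p : ℕ | p.Prime ∧ ¬ GoodPrime Fp p}) ⟨hp1, hg⟩]
      exact le_add_of_nonneg_left (Set.indicator_nonneg (fun p _ => hnn p) p)
  · rw [Set.indicator_of_notMem hp]
    exact add_nonneg (Set.indicator_nonneg (fun p _ => hnn p) p)
      (Set.indicator_nonneg (fun p _ => hnn p) p)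
end
end

section
/- For every real number γ with 0 < γ < 1, the set 𝒫 = {𝔭 a good prime ideal of 𝓞_K : m_𝔭(φ,P) ≥ (log N𝔭)^γ} has logarithmic analytic density 1; that is, (s−1)·Σ_{𝔭 ∈ 𝒫} (log N𝔭)/(N𝔭)^s tends to 1 as s → 1⁺. -/
open MvPolynomial NumberField Filter Topology

noncomputable section

/-- The map on integral vectors induced by the homogeneous polynomials `Fp i`. -/
def FmapK (K : Type) [Field K] [NumberField K] {N : ℕ}
    (Fp : Fin (N + 1) → MvPolynomial (Fin (N + 1)) (𝓞 K)) :
    (Fin (N + 1) → 𝓞 K) → (Fin (N + 1) → 𝓞 K) :=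
  fun b i => MvPolynomial.eval b (Fp i)

/-- A nonzero prime ideal `p` of `𝓞 K` is good (for `Fp` and `α`) if `p` does not contain the
ideal generated by the coordinates of `α`, and the reductions of the `Fp i` modulo `p` have no
common zero in an algebraic closure of the residue field `𝓞 K ⧸ p` other than the origin. -/
def GoodIdeal (K : Type) [Field K] [NumberField K] {N : ℕ}
    (Fp : Fin (N + 1) → MvPolynomial (Fin (N + 1)) (𝓞 K))
    (α : Fin (N + 1) → 𝓞 K) (p : Ideal (𝓞 K)) : Prop :=
  p.IsPrime ∧ p ≠ ⊥ ∧ ¬ (Ideal.span (Set.range α) ≤ p) ∧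
  ∃ hm : p.IsMaximal,
    letI : Field ((𝓞 K) ⧸ p) := @Ideal.Quotient.field _ _ p hm
    ∀ x : Fin (N + 1) → AlgebraicClosure ((𝓞 K) ⧸ p),
      (∀ i, MvPolynomial.aeval x ((Fp i).map (Ideal.Quotient.mk p)) = 0) → x = 0

/-- The number of distinct points of `ℙ^N(𝔽_p)` represented by the reductions mod `p` of the
iterates `F^[n](α)`, i.e. the size of the orbit of `P mod p`. -/
def orbitLenK (K : Type) [Field K] [NumberField K] {N : ℕ}
    (Fp : Fin (N + 1) → MvPolynomial (Fin (N + 1)) (𝓞 K))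
    (α : Fin (N + 1) → 𝓞 K) (p : Ideal (𝓞 K)) : ℕ :=
  Set.ncard (Set.range fun n : ℕ =>
    Quotient.mk (MulAction.orbitRel ((𝓞 K) ⧸ p)ˣ (Fin (N + 1) → (𝓞 K) ⧸ p))
      (fun i => Ideal.Quotient.mk p (((FmapK K Fp)^[n] α) i)))


theorem aux_le {a s t : ℝ} (ha : 1 ≤ a) :
    a ^ (-s) - (t - s) * (Real.log a * a ^ (-s)) ≤ a ^ (-t) := by
  have h0 : 0 < a := by linarith
  have h1 : a ^ (-t) = a ^ (-s) * Real.exp (-(Real.log a * (t - s))) := by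
    rw [Real.rpow_def_of_pos h0, Real.rpow_def_of_pos h0, ← Real.exp_add]; congr 1; ring
  rw [h1]
  have h2 := Real.add_one_le_exp (-(Real.log a * (t - s)))
  have h3 : 0 < a ^ (-s) := Real.rpow_pos_of_pos h0 _
  nlinarith

theorem log_summable {ι : Type*} {a : ι → ℝ} (ha : ∀ i, 1 ≤ a i)
    (hs : ∀ s : ℝ, 1 < s → Summable fun i => a i ^ (-s)) {s : ℝ} (h1 : 1 < s) :
    Summable fun i => Real.log (a i) * a i ^ (-s) := by
  have h := hs ((1 + s) / 2) (by linarith)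
  refine Summable.of_nonneg_of_le (fun i => ?_) (fun i => ?_) (h.mul_left (2 / (s - 1)))
  · have := Real.log_nonneg (ha i)
    have := Real.rpow_nonneg (zero_le_one.trans (ha i)) (-s)
    positivity
  · have := aux_le (s := s) (t := (1 + s) / 2) (ha i)
    have h3 : 0 ≤ a i ^ (-s) := Real.rpow_nonneg (zero_le_one.trans (ha i)) (-s)
    have : 0 < s - 1 := by linarith
    rw [div_mul_eq_mul_div, le_div_iff₀ this]
    nlinarith

theorem tendsto_log_sum {ι : Type*} {a : ι → ℝ} (ha : ∀ i, 1 ≤ a i)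
    (hs : ∀ s : ℝ, 1 < s → Summable fun i => a i ^ (-s)) {κ : ℝ}
    (hlim : Tendsto (fun s : ℝ => (s - 1) * ∑' i, a i ^ (-s)) (𝓝[>] 1) (𝓝 κ)) (hκ : 0 < κ) :
    Tendsto (fun s : ℝ => (s - 1) ^ 2 * ∑' i, Real.log (a i) * a i ^ (-s)) (𝓝[>] 1) (𝓝 κ) := by
  set Z : ℝ → ℝ := fun s => ∑' i, a i ^ (-s) with hZ
  set L : ℝ → ℝ := fun s => ∑' i, Real.log (a i) * a i ^ (-s) with hL
  -- key inequality
  have key : ∀ s t : ℝ, 1 < s → 1 < t → Z s - (t - s) * L s ≤ Z t := by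
    intro s t h1 h2
    have hl := log_summable ha hs h1
    simp only [hZ, hL]
    rw [← tsum_mul_left, ← (hs s h1).tsum_sub (hl.mul_left _)]
    exact ((hs s h1).sub (hl.mul_left _)).tsum_le_tsum (fun i => aux_le (ha i)) (hs t h2)
  have hdil : ∀ c : ℝ, 0 < c → Tendsto (fun s : ℝ => (s - 1) * Z (1 + c * (s - 1))) (𝓝[>] 1)
      (𝓝 (κ / c)) := by
    intro c hc
    have h1 : Tendsto (fun s : ℝ => 1 + c * (s - 1)) (𝓝[>] 1) (𝓝[>] 1) := by
      refine tendsto_nhdsWithin_iff.mpr ⟨?_, ?_⟩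
      · have : Tendsto (fun s : ℝ => 1 + c * (s - 1)) (𝓝 1) (𝓝 (1 + c * (1 - 1))) :=
          ContinuousAt.tendsto (by fun_prop)
        simp only [sub_self, mul_zero, add_zero] at this
        exact this.mono_left nhdsWithin_le_nhds
      · filter_upwards [self_mem_nhdsWithin] with s h
        have : 0 < s - 1 := sub_pos.mpr h
        have := mul_pos hc this
        simp only [Set.mem_Ioi]; linarith
    have h2 := (hlim.comp h1).div_const c
    refine h2.congr fun s => ?_
    simp only [Function.comp]
    field_simp
    simp [hZ]
  have hG : ∀ c : ℝ, 0 < c → c ≠ 1 → Tendsto (fun s : ℝ => ((s - 1) * Z s -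
      (s - 1) * Z (1 + c * (s - 1))) / (c - 1)) (𝓝[>] 1) (𝓝 (κ / c)) := by
    intro c hc hc1
    have h := (hlim.sub (hdil c hc)).div_const (c - 1)
    have hc2 : c - 1 ≠ 0 := sub_ne_zero.mpr hc1
    have e : (κ - κ / c) / (c - 1) = κ / c := by field_simp
    rw [e] at h
    exact h
  have hcont : Tendsto (fun c : ℝ => κ / c) (𝓝 1) (𝓝 κ) := by
    have : Tendsto (fun c : ℝ => κ / c) (𝓝 1) (𝓝 (κ / 1)) :=
      ContinuousAt.tendsto (by fun_prop (disch := norm_num))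
    simpa using this
  rw [tendsto_order]
  constructor
  · intro b hb
    have h1 : ∀ᶠ c in 𝓝[>] (1 : ℝ), b < κ / c :=
      (hcont.mono_left nhdsWithin_le_nhds).eventually (lt_mem_nhds hb)
    obtain ⟨c, hc, hc1⟩ := (h1.and self_mem_nhdsWithin).exists
    have hc1 : 1 < c := hc1
    filter_upwards [(hG c (by linarith) hc1.ne').eventually (lt_mem_nhds hc),
      self_mem_nhdsWithin] with s h2 h3
    have h3 : 1 < s := h3
    refine h2.trans_le ?_
    have hp : 0 < (c - 1) * (s - 1) := mul_pos (by linarith) (by linarith)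
    have := key s (1 + c * (s - 1)) h3 (by nlinarith)
    rw [div_le_iff₀ (by linarith)]
    have h5 := mul_le_mul_of_nonneg_left this (show 0 ≤ s - 1 by linarith)
    change _ ≤ (s - 1) ^ 2 * L s * (c - 1)
    linarith
  · intro b hb
    have h1 : ∀ᶠ c in 𝓝[<] (1 : ℝ), κ / c < b :=
      (hcont.mono_left nhdsWithin_le_nhds).eventually (gt_mem_nhds hb)
    have h0 : ∀ᶠ c in 𝓝[<] (1 : ℝ), 0 < c :=
      nhdsWithin_le_nhds (lt_mem_nhds one_pos)
    obtain ⟨c, ⟨hc, hc0⟩, hc1⟩ := ((h1.and h0).and self_mem_nhdsWithin).exists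
    have hc1 : c < 1 := hc1
    filter_upwards [(hG c hc0 hc1.ne).eventually (gt_mem_nhds hc),
      self_mem_nhdsWithin] with s h2 h3
    have h3 : 1 < s := h3
    refine lt_of_le_of_lt ?_ h2
    have hp : 0 < (1 - c) * (s - 1) := mul_pos (by linarith) (by linarith)
    have hp' : 0 < c * (s - 1) := mul_pos (by linarith) (by linarith)
    have := key s (1 + c * (s - 1)) h3 (by nlinarith)
    rw [le_div_iff_of_neg (by linarith)]
    have h5 := mul_le_mul_of_nonneg_left this (show 0 ≤ s - 1 by linarith)
    change _ ≤ (s - 1) ^ 2 * L s * (c - 1)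
    linarith

theorem fiber_card (K : Type) [Field K] [NumberField K] (n : ℕ) (hn : n ≠ 0) :
    Nat.card {I : {I : Ideal (𝓞 K) // I ≠ ⊥} // Ideal.absNorm I.1 = n} =
      Nat.card {I : Ideal (𝓞 K) // Ideal.absNorm I = n} := by
  refine Nat.card_congr ⟨fun I => ⟨I.1.1, I.2⟩, fun I => ⟨⟨I.1, ?_⟩, I.2⟩, fun I => rfl, fun I => rfl⟩
  rintro h
  have := I.2
  rw [h] at this
  simp at this
  exact hn this.symm

theorem fiber_finite (K : Type) [Field K] [NumberField K] (n : ℕ) :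
    Finite {I : {I : Ideal (𝓞 K) // I ≠ ⊥} // Ideal.absNorm I.1 = n} := by
  have : Finite {I : Ideal (𝓞 K) // Ideal.absNorm I = n} :=
    (Ideal.finite_setOfPred_absNorm_eq n).to_subtype
  exact Finite.of_injective (β := {I : Ideal (𝓞 K) // Ideal.absNorm I = n})
    (fun I => ⟨I.1.1, I.2⟩) (fun I J h => by
      apply Subtype.ext; apply Subtype.ext
      simpa using h)

theorem term_eq (K : Type) [Field K] [NumberField K] {s : ℝ} (hs : s ≠ 0) (n : ℕ) :
    LSeries.term (fun n ↦ (Nat.card {I : Ideal (𝓞 K) // Ideal.absNorm I = n} : ℂ)) s n =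
      ((∑' I : {I : {I : Ideal (𝓞 K) // I ≠ ⊥} // Ideal.absNorm I.1 = n},
        (Ideal.absNorm I.1.1 : ℝ) ^ (-s) : ℝ) : ℂ) := by
  have h : ∀ I : {I : {I : Ideal (𝓞 K) // I ≠ ⊥} // Ideal.absNorm I.1 = n},
        (Ideal.absNorm I.1.1 : ℝ) ^ (-s) = (n : ℝ) ^ (-s) := fun I => by rw [I.2]
  have := fiber_finite K n
  simp_rw [h]
  rw [tsum_const]
  rcases eq_or_ne n 0 with rfl | hn
  · simp [Real.zero_rpow, hs]
  · rw [fiber_card K n hn, LSeries.term_of_ne_zero hn, nsmul_eq_mul, Real.rpow_neg (by positivity)]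
    push_cast
    rw [Complex.ofReal_cpow (by positivity)]
    simp [div_eq_mul_inv]

theorem zeta_sum (K : Type) [Field K] [NumberField K] {s : ℝ} (hs : s ≠ 0)
    (h : LSeriesSummable (fun n ↦ (Nat.card {I : Ideal (𝓞 K) // Ideal.absNorm I = n} : ℂ)) s) :
    Summable (fun I : {I : Ideal (𝓞 K) // I ≠ ⊥} => (Ideal.absNorm I.1 : ℝ) ^ (-s)) ∧
    NumberField.dedekindZeta K s =
      ((∑' I : {I : Ideal (𝓞 K) // I ≠ ⊥}, (Ideal.absNorm I.1 : ℝ) ^ (-s) : ℝ) : ℂ) := by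
  set e := Equiv.sigmaFiberEquiv (fun I : {I : Ideal (𝓞 K) // I ≠ ⊥} => Ideal.absNorm I.1)
  have hsum : Summable (fun I : {I : Ideal (𝓞 K) // I ≠ ⊥} => (Ideal.absNorm I.1 : ℝ) ^ (-s)) := by
    rw [← e.summable_iff, summable_sigma_of_nonneg (fun _ => by simp only [Function.comp]; positivity)]
    constructor
    · intro n
      have := fiber_finite K n
      exact Summable.of_finite
    · have h2 : Summable (fun n => LSeries.term (fun n ↦
        (Nat.card {I : Ideal (𝓞 K) // Ideal.absNorm I = n} : ℂ)) s n) := h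
      simp_rw [term_eq K hs] at h2
      exact Complex.summable_ofReal.mp h2
  refine ⟨hsum, ?_⟩
  have h3 := (e.tsum_eq (fun I : {I : Ideal (𝓞 K) // I ≠ ⊥} =>
    (Ideal.absNorm I.1 : ℝ) ^ (-s))).symm.trans (Summable.tsum_sigma' (fun n => by
    have := fiber_finite K n
    exact Summable.of_finite) (e.summable_iff.mpr hsum))
  rw [h3, NumberField.dedekindZeta, LSeries]
  simp_rw [term_eq K hs]
  rw [Complex.ofReal_tsum]
  rfl

theorem zeta_all (K : Type) [Field K] [NumberField K] :
    (∀ s : ℝ, 1 < s →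
      Summable (fun I : {I : Ideal (𝓞 K) // I ≠ ⊥} => (Ideal.absNorm I.1 : ℝ) ^ (-s))) ∧
    Tendsto (fun s : ℝ => (s - 1) * ∑' I : {I : Ideal (𝓞 K) // I ≠ ⊥},
      (Ideal.absNorm I.1 : ℝ) ^ (-s)) (𝓝[>] 1) (𝓝 (NumberField.dedekindZeta_residue K)) := by
  have hl := NumberField.tendsto_sub_one_mul_dedekindZeta_nhdsGT K
  have hne : ∀ᶠ s : ℝ in 𝓝[>] 1, ((s : ℂ) - 1) * NumberField.dedekindZeta K s ≠ 0 :=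
    hl.eventually_ne (by exact_mod_cast NumberField.dedekindZeta_residue_ne_zero K)
  have hS : ∀ s : ℝ, 1 < s →
      LSeriesSummable (fun n ↦ (Nat.card {I : Ideal (𝓞 K) // Ideal.absNorm I = n} : ℂ)) s := by
    intro s hs
    obtain ⟨t, ht, hts⟩ := (hne.and (Ioo_mem_nhdsGT hs)).exists
    have h1 : LSeriesSummable
        (fun n ↦ (Nat.card {I : Ideal (𝓞 K) // Ideal.absNorm I = n} : ℂ)) t := by
      by_contra hcon
      apply ht
      rw [NumberField.dedekindZeta, LSeries, tsum_eq_zero_of_not_summable hcon, mul_zero]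
    exact h1.of_re_le_re (by simpa using hts.2.le)
  refine ⟨fun s hs => (zeta_sum K (by linarith) (hS s hs)).1, ?_⟩
  have h2 : Tendsto (fun s : ℝ => (((s - 1) * ∑' I : {I : Ideal (𝓞 K) // I ≠ ⊥},
      (Ideal.absNorm I.1 : ℝ) ^ (-s) : ℝ) : ℂ)) (𝓝[>] 1)
      (𝓝 ((NumberField.dedekindZeta_residue K : ℝ) : ℂ)) := by
    refine hl.congr' ?_
    filter_upwards [self_mem_nhdsWithin] with s hs
    have hs : 1 < s := hs
    rw [(zeta_sum K (by linarith) (hS s hs)).2]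
    push_cast
    rfl
  exact tendsto_ofReal_iff.mp h2

/-- nonzero primes -/
abbrev PP (K : Type) [Field K] [NumberField K] := {p : Ideal (𝓞 K) // p.IsPrime ∧ p ≠ ⊥}

/-- nonzero ideals -/
abbrev NI (K : Type) [Field K] [NumberField K] := {I : Ideal (𝓞 K) // I ≠ ⊥}

theorem norm_ge_one (K : Type) [Field K] [NumberField K] (I : NI K) :
    1 ≤ (Ideal.absNorm I.1 : ℝ) := by
  have : Ideal.absNorm I.1 ≠ 0 := by
    rw [Ne, Ideal.absNorm_eq_zero_iff]; exact I.2
  exact_mod_cast Nat.one_le_iff_ne_zero.mpr this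

theorem norm_ge_two (K : Type) [Field K] [NumberField K] (p : PP K) :
    2 ≤ (Ideal.absNorm p.1 : ℝ) := by
  have h0 : Ideal.absNorm p.1 ≠ 0 := by
    rw [Ne, Ideal.absNorm_eq_zero_iff]; exact p.2.2
  have h1 : Ideal.absNorm p.1 ≠ 1 := by
    rw [Ne, Ideal.absNorm_eq_one_iff]; exact p.2.1.ne_top
  have : 2 ≤ Ideal.absNorm p.1 := by omega
  exact_mod_cast this

theorem mangoldt (K : Type) [Field K] [NumberField K] (I : Ideal (𝓞 K)) (hI : I ≠ ⊥) :
    ENNReal.ofReal (Real.log (Ideal.absNorm I)) = ∑' p : PP K, ∑' k : ℕ,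
      open Classical in
      if p.1 ^ (k + 1) ∣ I then ENNReal.ofReal (Real.log (Ideal.absNorm p.1)) else 0 := by
  classical
  induction I using UniqueFactorizationMonoid.induction_on_prime with
  | h₁ => exact absurd rfl hI
  | h₂ I hu =>
    have hI1 : I = 1 := by simpa using Ideal.isUnit_iff.mp hu
    subst hI1
    have : ∀ (p : PP K) (k : ℕ), ¬ p.1 ^ (k + 1) ∣ 1 := by
      intro p k h
      have h2 := (dvd_pow_self p.1 (Nat.succ_ne_zero k)).trans h
      rw [← isUnit_iff_dvd_one, Ideal.isUnit_iff] at h2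
      exact p.2.1.ne_top h2
    simp only [this, if_false, tsum_zero]
    simp
  | h₃ J q hJ hq ih =>
    have hq0 : q ≠ ⊥ := hq.ne_zero
    have ih := ih hJ
    let Q : PP K := ⟨q, Ideal.isPrime_of_prime hq, hq0⟩
    have hstep : ∀ p : PP K, (∑' k : ℕ,
        if p.1 ^ (k + 1) ∣ q * J then ENNReal.ofReal (Real.log (Ideal.absNorm p.1)) else 0) =
        (if p = Q then ENNReal.ofReal (Real.log (Ideal.absNorm q)) else 0) + ∑' k : ℕ,
        if p.1 ^ (k + 1) ∣ J then ENNReal.ofReal (Real.log (Ideal.absNorm p.1)) else 0 := by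
      intro p
      by_cases hp : p = Q
      · subst hp
        rw [tsum_eq_zero_add' ENNReal.summable]
        simp only [zero_add, pow_one, if_true, Q]
        rw [if_pos (dvd_mul_right q J)]
        congr 1
        refine tsum_congr fun k => ?_
        rw [pow_succ' q (k + 1), mul_dvd_mul_iff_left hq.ne_zero]
      · have hnd : ¬ p.1 ∣ q := by
          intro h
          apply hp
          apply Subtype.ext
          have := Ideal.le_of_dvd h
          have hm : q.IsMaximal := Ideal.IsPrime.isMaximal Q.2.1 hq0
          exact (hm.eq_of_le p.2.1.ne_top this).symm
        have hpp : Prime p.1 := Ideal.prime_of_isPrime p.2.2 p.2.1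
        have : ∀ k, p.1 ^ (k + 1) ∣ q * J ↔ p.1 ^ (k + 1) ∣ J := fun k =>
          ⟨fun h => hpp.pow_dvd_of_dvd_mul_left _ hnd h, fun h => h.mul_left _⟩
        simp [this, hp]
    simp_rw [hstep]
    rw [ENNReal.tsum_add, tsum_ite_eq, ← ih, map_mul]
    have h1 := norm_ge_one K ⟨J, hJ⟩
    have h2 := norm_ge_one K ⟨q, hq0⟩
    simp only at h1 h2
    push_cast
    rw [Real.log_mul (by positivity) (by positivity), ENNReal.ofReal_add (Real.log_nonneg h2)
      (Real.log_nonneg h1)]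

/-- weight -/
noncomputable def wt (K : Type) [Field K] [NumberField K] (s : ℝ) (I : Ideal (𝓞 K)) : ENNReal :=
  ENNReal.ofReal ((Ideal.absNorm I : ℝ) ^ (-s))

theorem wt_mul (K : Type) [Field K] [NumberField K] (s : ℝ) (I J : Ideal (𝓞 K)) :
    wt K s (I * J) = wt K s I * wt K s J := by
  unfold wt
  rw [map_mul, ← ENNReal.ofReal_mul (by positivity), Nat.cast_mul,
    Real.mul_rpow (by positivity) (by positivity)]

theorem wt_pow (K : Type) [Field K] [NumberField K] (s : ℝ) (I : Ideal (𝓞 K)) (k : ℕ) :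
    wt K s (I ^ k) = wt K s I ^ k := by
  induction k with
  | zero => simp [wt]
  | succ k ih => rw [pow_succ, wt_mul, ih, pow_succ]

theorem sum_dvd (K : Type) [Field K] [NumberField K] (s : ℝ) (Q : Ideal (𝓞 K)) (hQ : Q ≠ ⊥) :
    (∑' I : NI K, open Classical in if Q ∣ I.1 then wt K s I.1 else 0) =
      wt K s Q * ∑' I : NI K, wt K s I.1 := by
  classical
  let g : NI K → NI K := fun J => ⟨Q * J.1, mul_ne_zero hQ J.2⟩
  have hg : Function.Injective g := by
    intro A B h
    have := congrArg Subtype.val h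
    exact Subtype.ext (mul_left_cancel₀ hQ this)
  rw [← hg.tsum_eq (f := fun I : NI K => if Q ∣ I.1 then wt K s I.1 else 0)]
  · rw [← ENNReal.tsum_mul_left]
    refine tsum_congr fun J => ?_
    simp [g, wt_mul]
  · intro I hI
    simp only [Function.mem_support, ne_eq, ite_eq_right_iff, not_forall] at hI
    obtain ⟨⟨J, hJ⟩, -⟩ := hI
    have hJ0 : J ≠ ⊥ := by
      rintro rfl
      apply I.2
      rw [hJ]; simp
    exact ⟨⟨J, hJ0⟩, Subtype.ext hJ.symm⟩

theorem LZ (K : Type) [Field K] [NumberField K] (s : ℝ) :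
    (∑' I : NI K, ENNReal.ofReal (Real.log (Ideal.absNorm I.1)) * wt K s I.1) =
    ((∑' p : PP K, ENNReal.ofReal (Real.log (Ideal.absNorm p.1)) * wt K s p.1) +
      ∑' p : PP K, ∑' k : ℕ, ENNReal.ofReal (Real.log (Ideal.absNorm p.1)) * wt K s p.1 ^ (k + 2))
      * ∑' I : NI K, wt K s I.1 := by
  classical
  have h1 : ∀ I : NI K, ENNReal.ofReal (Real.log (Ideal.absNorm I.1)) * wt K s I.1 =
      ∑' p : PP K, ∑' k : ℕ, ENNReal.ofReal (Real.log (Ideal.absNorm p.1)) *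
        (if p.1 ^ (k + 1) ∣ I.1 then wt K s I.1 else 0) := by
    intro I
    rw [mangoldt K I.1 I.2, ← ENNReal.tsum_mul_right]
    refine tsum_congr fun p => ?_
    rw [← ENNReal.tsum_mul_right]
    refine tsum_congr fun k => ?_
    split_ifs <;> simp
  simp_rw [h1]
  rw [ENNReal.tsum_comm, ← ENNReal.tsum_add, ← ENNReal.tsum_mul_right]
  refine tsum_congr fun p => ?_
  rw [ENNReal.tsum_comm]
  simp_rw [ENNReal.tsum_mul_left]
  have h2 : ∀ k : ℕ, (∑' I : NI K, if p.1 ^ (k + 1) ∣ I.1 then wt K s I.1 else 0) =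
      wt K s p.1 ^ (k + 1) * ∑' I : NI K, wt K s I.1 := fun k => by
    rw [← wt_pow]
    convert! sum_dvd K s (p.1 ^ (k + 1)) (pow_ne_zero _ p.2.2)
  simp_rw [h2]
  rw [ENNReal.tsum_mul_right, tsum_eq_zero_add' ENNReal.summable]
  simp only [zero_add, pow_one]
  ring

theorem PP_summable (K : Type) [Field K] [NumberField K] {s : ℝ} (hs : 1 < s) :
    Summable fun p : PP K => Real.log (Ideal.absNorm p.1) * (Ideal.absNorm p.1 : ℝ) ^ (-s) := by
  have h : Summable fun I : NI K =>
      Real.log (Ideal.absNorm I.1) * (Ideal.absNorm I.1 : ℝ) ^ (-s) :=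
    log_summable (a := fun I : NI K => (Ideal.absNorm I.1 : ℝ)) (norm_ge_one K) (zeta_all K).1 hs
  have hi : Function.Injective (fun p : PP K => (⟨p.1, p.2.2⟩ : NI K)) := by
    intro p q h
    have h2 := congrArg (fun I : NI K => I.1) h
    exact Subtype.ext h2
  have h3 := h.comp_injective hi
  simp only [Function.comp_def] at h3
  exact h3

theorem log_norm_nonneg (K : Type) [Field K] [NumberField K] (I : Ideal (𝓞 K)) :
    0 ≤ Real.log (Ideal.absNorm I) := Real.log_natCast_nonneg _

theorem Q_term (K : Type) [Field K] [NumberField K] {s : ℝ} (hs : 1 ≤ s) (p : PP K) :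
    (∑' k : ℕ, ENNReal.ofReal (Real.log (Ideal.absNorm p.1)) * wt K s p.1 ^ (k + 2)) ≤
      2 * ENNReal.ofReal (Real.log (Ideal.absNorm p.1) * (Ideal.absNorm p.1 : ℝ) ^ (-2 : ℝ)) := by
  have h2 := norm_ge_two K p
  have hw : wt K s p.1 ≤ wt K 1 p.1 :=
    ENNReal.ofReal_le_ofReal (Real.rpow_le_rpow_of_exponent_le (by linarith) (by linarith))
  have hw1 : wt K 1 p.1 ≤ 2⁻¹ := by
    unfold wt
    rw [Real.rpow_neg_one, ENNReal.ofReal_le_iff_le_toReal (by simp)]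
    simp only [ENNReal.toReal_inv, ENNReal.toReal_ofNat]
    exact inv_anti₀ (by norm_num) h2
  have hw2 : wt K 1 p.1 ^ 2 = ENNReal.ofReal ((Ideal.absNorm p.1 : ℝ) ^ (-2 : ℝ)) := by
    unfold wt
    rw [← ENNReal.ofReal_pow (by positivity), ← Real.rpow_natCast, ← Real.rpow_mul (by positivity)]
    norm_num
  calc _ ≤ ∑' k : ℕ, ENNReal.ofReal (Real.log (Ideal.absNorm p.1)) * wt K 1 p.1 ^ 2 * 2⁻¹ ^ k := by
        refine ENNReal.tsum_le_tsum fun k => ?_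
        rw [pow_add, mul_assoc, mul_comm (_ ^ k)]
        gcongr
        exact hw.trans hw1
    _ = _ := by
        rw [ENNReal.tsum_mul_left, ENNReal.tsum_geometric, hw2,
          ENNReal.ofReal_mul (log_norm_nonneg K _)]
        rw [mul_comm]; congr 1
        rw [ENNReal.one_sub_inv_two, inv_inv]

theorem primes_tendsto (K : Type) [Field K] [NumberField K] :
    Tendsto (fun s : ℝ => (s - 1) * ∑' p : PP K,
      Real.log (Ideal.absNorm p.1) * (Ideal.absNorm p.1 : ℝ) ^ (-s)) (𝓝[>] 1) (𝓝 1) := by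
  obtain ⟨hsum, hlim⟩ := zeta_all K
  have hκ := NumberField.dedekindZeta_residue_pos K
  set κ := NumberField.dedekindZeta_residue K
  have hL := tendsto_log_sum (norm_ge_one K) hsum hlim hκ
  set Z : ℝ → ℝ := fun s => ∑' I : NI K, (Ideal.absNorm I.1 : ℝ) ^ (-s) with hZ
  set L : ℝ → ℝ := fun s => ∑' I : NI K, Real.log (Ideal.absNorm I.1) *
    (Ideal.absNorm I.1 : ℝ) ^ (-s) with hLdef
  set P : ℝ → ℝ := fun s => ∑' p : PP K, Real.log (Ideal.absNorm p.1) *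
    (Ideal.absNorm p.1 : ℝ) ^ (-s) with hP
  let Q : ℝ → ENNReal := fun s => ∑' p : PP K, ∑' k : ℕ,
    ENNReal.ofReal (Real.log (Ideal.absNorm p.1)) * wt K s p.1 ^ (k + 2)
  set C : ℝ := 2 * ∑' p : PP K, Real.log (Ideal.absNorm p.1) * (Ideal.absNorm p.1 : ℝ) ^ (-2 : ℝ)
  have hC : 0 ≤ C := mul_nonneg zero_le_two (tsum_nonneg fun p =>
    mul_nonneg (log_norm_nonneg K _) (by positivity))
  have hQ : ∀ s : ℝ, 1 ≤ s → Q s ≤ ENNReal.ofReal C := by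
    intro s hs
    refine (ENNReal.tsum_le_tsum fun p => Q_term K hs p).trans ?_
    rw [ENNReal.tsum_mul_left, ENNReal.ofReal_mul zero_le_two, ENNReal.ofReal_tsum_of_nonneg
      (fun p => mul_nonneg (log_norm_nonneg K _) (by positivity)) (PP_summable K one_lt_two)]
    simp
  have hid : ∀ s : ℝ, 1 < s → L s = (P s + (Q s).toReal) * Z s := by
    intro s hs
    have h := LZ K s
    have e1 : (∑' I : NI K, ENNReal.ofReal (Real.log (Ideal.absNorm I.1)) * wt K s I.1) =
        ENNReal.ofReal (L s) := by
      rw [hLdef, ENNReal.ofReal_tsum_of_nonneg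
        (fun p => mul_nonneg (log_norm_nonneg K _) (by positivity))
        (log_summable (norm_ge_one K) hsum hs)]
      exact tsum_congr fun I => (ENNReal.ofReal_mul (log_norm_nonneg K _)).symm
    have e2 : (∑' I : PP K, ENNReal.ofReal (Real.log (Ideal.absNorm I.1)) * wt K s I.1) =
        ENNReal.ofReal (P s) := by
      rw [hP, ENNReal.ofReal_tsum_of_nonneg
        (fun p => mul_nonneg (log_norm_nonneg K _) (by positivity))
        (PP_summable K hs)]
      exact tsum_congr fun I => (ENNReal.ofReal_mul (log_norm_nonneg K _)).symm
    have e3 : (∑' I : NI K, wt K s I.1) = ENNReal.ofReal (Z s) := by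
      rw [hZ, ENNReal.ofReal_tsum_of_nonneg (fun p => by positivity) (hsum s hs)]
      rfl
    rw [e1, e2, e3] at h
    have h := congrArg ENNReal.toReal h
    have hQt : Q s ≠ ⊤ := ne_top_of_le_ne_top ENNReal.ofReal_ne_top (hQ s hs.le)
    rw [ENNReal.toReal_mul, ENNReal.toReal_add ENNReal.ofReal_ne_top hQt,
      ENNReal.toReal_ofReal, ENNReal.toReal_ofReal, ENNReal.toReal_ofReal] at h
    · exact h
    · exact tsum_nonneg fun p => by positivity
    · exact tsum_nonneg fun p => mul_nonneg (log_norm_nonneg K _) (by positivity)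
    · exact tsum_nonneg fun p => mul_nonneg (log_norm_nonneg K _) (by positivity)
  have hs1 : Tendsto (fun s : ℝ => s - 1) (𝓝[>] 1) (𝓝 0) := by
    have : Tendsto (fun s : ℝ => s - 1) (𝓝 1) (𝓝 (1 - 1)) := ContinuousAt.tendsto (by fun_prop)
    rw [sub_self] at this
    exact this.mono_left nhdsWithin_le_nhds
  have hQ0 : Tendsto (fun s : ℝ => (s - 1) * (Q s).toReal) (𝓝[>] 1) (𝓝 0) := by
    have h1 := hs1.mul_const C
    rw [zero_mul] at h1
    refine tendsto_of_tendsto_of_tendsto_of_le_of_le' tendsto_const_nhds h1 ?_ ?_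
    · filter_upwards [self_mem_nhdsWithin] with s hs
      have hs : 1 < s := hs
      exact mul_nonneg (by linarith) ENNReal.toReal_nonneg
    · filter_upwards [self_mem_nhdsWithin] with s hs
      have hs : 1 < s := hs
      refine mul_le_mul_of_nonneg_left ?_ (by linarith)
      exact ENNReal.toReal_le_of_le_ofReal hC (hQ s hs.le)
  have h := (hL.div hlim hκ.ne').sub hQ0
  rw [div_self hκ.ne', sub_zero] at h
  refine h.congr' ?_
  filter_upwards [self_mem_nhdsWithin, hlim.eventually_ne hκ.ne'] with s hs hne
  have hs : 1 < s := hs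
  have hne' : Z s ≠ 0 := right_ne_zero_of_mul hne
  have hsn : s - 1 ≠ 0 := by linarith
  change (s - 1) ^ 2 * L s / ((s - 1) * Z s) - _ = (s - 1) * P s
  rw [hid s hs]
  field_simp
  ring

section

attribute [local instance] MvPolynomial.algebraMvPolynomial
theorem denom (K : Type) [Field K] [NumberField K] {N : ℕ}
    (Fp : Fin (N + 1) → MvPolynomial (Fin (N + 1)) (𝓞 K))
    (hzero : ∀ x : Fin (N + 1) → AlgebraicClosure K,
      (∀ i, MvPolynomial.aeval x ((Fp i).map (algebraMap (𝓞 K) K)) = 0) → x = 0)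
    (i : Fin (N + 1)) :
    ∃ (m : ℕ) (D : 𝓞 K), D ≠ 0 ∧ C D * X i ^ m ∈ Ideal.span (Set.range Fp) := by
  let J : Ideal (MvPolynomial (Fin (N + 1)) K) :=
    Ideal.span (Set.range fun j => (Fp j).map (algebraMap (𝓞 K) K))
  have h1 : (X i : MvPolynomial (Fin (N + 1)) K) ∈ J.radical := by
    rw [← MvPolynomial.vanishingIdeal_zeroLocus_eq_radical (K := AlgebraicClosure K),
      mem_vanishingIdeal_iff]
    intro x hx
    rw [mem_zeroLocus_iff] at hx
    have := hzero x fun j => hx _ (Ideal.subset_span ⟨j, rfl⟩)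
    simp [this]
  obtain ⟨m, hm⟩ := h1
  have hJ : J = Ideal.map (algebraMap (MvPolynomial (Fin (N + 1)) (𝓞 K))
      (MvPolynomial (Fin (N + 1)) K)) (Ideal.span (Set.range Fp)) := by
    rw [Ideal.map_span, ← Set.range_comp]
    rfl
  rw [hJ, IsLocalization.mem_map_algebraMap_iff
    (Submonoid.map (C : 𝓞 K →+* MvPolynomial (Fin (N + 1)) (𝓞 K)) (nonZeroDivisors (𝓞 K)))] at hm
  obtain ⟨⟨a, ⟨b, D, hD, rfl⟩⟩, hab⟩ := hm
  refine ⟨m, D, nonZeroDivisors.ne_zero hD, ?_⟩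
  have hinj : Function.Injective (algebraMap (MvPolynomial (Fin (N + 1)) (𝓞 K))
      (MvPolynomial (Fin (N + 1)) K)) :=
    MvPolynomial.map_injective _ (FaithfulSMul.algebraMap_injective (𝓞 K) K)
  have : C D * X i ^ m = (a : MvPolynomial (Fin (N + 1)) (𝓞 K)) := by
    apply hinj
    have hX : algebraMap (MvPolynomial (Fin (N + 1)) (𝓞 K)) (MvPolynomial (Fin (N + 1)) K) (X i) =
      X i := MvPolynomial.map_X _ _
    rw [← hab, map_mul, map_pow, mul_comm, hX]
  rw [this]
  exact a.2

end

theorem good_of (K : Type) [Field K] [NumberField K] {N : ℕ}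
    (Fp : Fin (N + 1) → MvPolynomial (Fin (N + 1)) (𝓞 K))
    (hzero : ∀ x : Fin (N + 1) → AlgebraicClosure K,
      (∀ i, MvPolynomial.aeval x ((Fp i).map (algebraMap (𝓞 K) K)) = 0) → x = 0)
    (α : Fin (N + 1) → 𝓞 K) (hα : α ≠ 0) :
    ∃ D : 𝓞 K, D ≠ 0 ∧ ∀ p : Ideal (𝓞 K), p.IsPrime → p ≠ ⊥ → D ∉ p → GoodIdeal K Fp α p := by
  choose m D hD hmem using denom K Fp hzero
  obtain ⟨i0, hi0⟩ := Function.ne_iff.mp hα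
  refine ⟨α i0 * ∏ i, D i, mul_ne_zero hi0 (Finset.prod_ne_zero_iff.mpr fun i _ => hD i), ?_⟩
  intro p hp hp0 hDp
  have hm : p.IsMaximal := hp.isMaximal hp0
  refine ⟨hp, hp0, ?_, hm, ?_⟩
  · intro h
    exact hDp (p.mul_mem_right _ (h (Ideal.subset_span ⟨i0, rfl⟩)))
  · let : Field ((𝓞 K) ⧸ p) := @Ideal.Quotient.field _ _ p hm
    intro x hx
    funext i
    let ev : MvPolynomial (Fin (N + 1)) (𝓞 K) →+* AlgebraicClosure ((𝓞 K) ⧸ p) :=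
      (MvPolynomial.aeval x : MvPolynomial (Fin (N + 1)) ((𝓞 K) ⧸ p) →ₐ[(𝓞 K) ⧸ p] _).toRingHom.comp
        (MvPolynomial.map (Ideal.Quotient.mk p))
    have h1 : Ideal.span (Set.range Fp) ≤ RingHom.ker ev := by
      rw [Ideal.span_le]
      rintro _ ⟨j, rfl⟩
      exact hx j
    have h2 := h1 (hmem i)
    rw [RingHom.mem_ker] at h2
    have h3 : ev (C (D i) * X i ^ m i) =
        algebraMap ((𝓞 K) ⧸ p) _ (Ideal.Quotient.mk p (D i)) * x i ^ m i := by
      simp [ev]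
    rw [h3, mul_eq_zero] at h2
    rcases h2 with h2 | h2
    · exfalso
      rw [map_eq_zero_iff _ (FaithfulSMul.algebraMap_injective _ _), Ideal.Quotient.eq_zero_iff_mem] at h2
      exact hDp (p.mul_mem_left _ (Ideal.mem_of_dvd p (Finset.dvd_prod_of_mem D (Finset.mem_univ i)) h2))
    · exact eq_zero_of_pow_eq_zero h2

theorem eval_bound (K : Type) [Field K] [NumberField K] {N d : ℕ}
    (P : MvPolynomial (Fin (N + 1)) (𝓞 K)) (hP : P.IsHomogeneous d)
    (b : Fin (N + 1) → 𝓞 K) (σ : K →+* ℂ) {R : ℝ} (hR : 1 ≤ R)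
    (hb : ∀ i, ‖σ (b i)‖ ≤ R) :
    ‖σ ((MvPolynomial.eval b P : 𝓞 K) : K)‖ ≤ (∑ m ∈ P.support, ‖σ ((P.coeff m : 𝓞 K) : K)‖) * R ^ d := by
  have e : σ ((MvPolynomial.eval b P : 𝓞 K) : K) =
      ∑ m ∈ P.support, σ ((P.coeff m : 𝓞 K) : K) * ∏ i, σ (b i : K) ^ m i := by
    rw [MvPolynomial.eval_eq']
    simp
  rw [e, Finset.sum_mul]
  refine (norm_sum_le _ _).trans (Finset.sum_le_sum fun m hm => ?_)
  rw [norm_mul]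
  refine mul_le_mul_of_nonneg_left ?_ (norm_nonneg _)
  rw [norm_prod]
  calc ∏ i, ‖σ (b i : K) ^ m i‖ ≤ ∏ i, R ^ m i := by
        refine Finset.prod_le_prod (fun i _ => norm_nonneg _) fun i _ => ?_
        rw [norm_pow]
        exact pow_le_pow_left₀ (norm_nonneg _) (hb i) _
    _ = R ^ (∑ i, m i) := Finset.prod_pow_eq_pow_sum _ _ _
    _ ≤ R ^ d := by
        refine pow_le_pow_right₀ hR ?_
        have := (MvPolynomial.le_totalDegree hm).trans hP.totalDegree_le
        rwa [Finsupp.sum_fintype _ _ (fun _ => rfl)] at this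

theorem iter_bound (K : Type) [Field K] [NumberField K] {N d : ℕ}
    (Fp : Fin (N + 1) → MvPolynomial (Fin (N + 1)) (𝓞 K))
    (hhom : ∀ i, (Fp i).IsHomogeneous d) (α : Fin (N + 1) → 𝓞 K) :
    ∃ B : ℝ, 2 ≤ B ∧ ∀ (n : ℕ) (σ : K →+* ℂ) (i : Fin (N + 1)),
      ‖σ (((FmapK K Fp)^[n] α i : 𝓞 K) : K)‖ ≤ B ^ ((d + 1) ^ n) := by
  set A1 : ℝ := ∑ σ : K →+* ℂ, ∑ i, ‖σ (α i : K)‖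
  set A2 : ℝ := ∑ σ : K →+* ℂ, ∑ i, ∑ m ∈ (Fp i).support, ‖σ (((Fp i).coeff m : 𝓞 K) : K)‖
  have h1 : 0 ≤ A1 := by positivity
  have h2 : 0 ≤ A2 := by positivity
  have hA1 : ∀ (σ : K →+* ℂ) i, ‖σ (α i : K)‖ ≤ A1 := fun σ i =>
    (Finset.single_le_sum (f := fun i => ‖σ (α i : K)‖) (fun i _ => norm_nonneg _)
      (Finset.mem_univ i)).trans
    (Finset.single_le_sum (f := fun σ : K →+* ℂ => ∑ i, ‖σ (α i : K)‖)
      (fun i _ => by positivity) (Finset.mem_univ σ))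
  have hA2 : ∀ (σ : K →+* ℂ) i, ∑ m ∈ (Fp i).support, ‖σ (((Fp i).coeff m : 𝓞 K) : K)‖ ≤ A2 := fun σ i =>
    (Finset.single_le_sum (f := fun i => ∑ m ∈ (Fp i).support, ‖σ (((Fp i).coeff m : 𝓞 K) : K)‖)
      (fun i _ => by positivity) (Finset.mem_univ i)).trans
    (Finset.single_le_sum (f := fun σ : K →+* ℂ => ∑ i, ∑ m ∈ (Fp i).support,
      ‖σ (((Fp i).coeff m : 𝓞 K) : K)‖)
      (fun i _ => by positivity) (Finset.mem_univ σ))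
  refine ⟨2 + A1 + A2, by linarith, fun n => ?_⟩
  set B := 2 + A1 + A2 with hB
  have hB1 : 1 ≤ B := by linarith
  induction n with
  | zero =>
    intro σ i
    simp only [Function.iterate_zero, id, pow_zero, pow_one]
    linarith [hA1 σ i]
  | succ n ih =>
    intro σ i
    rw [Function.iterate_succ_apply']
    refine (eval_bound K (Fp i) (hhom i) _ σ (one_le_pow₀ hB1) (ih σ)).trans ?_
    calc _ ≤ B * (B ^ (d + 1) ^ n) ^ d := by
          refine mul_le_mul_of_nonneg_right ?_ (by positivity)
          linarith [hA2 σ i]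
      _ = B ^ (1 + (d + 1) ^ n * d) := by rw [pow_add, pow_one, pow_mul]
      _ ≤ _ := by
          refine pow_le_pow_right₀ hB1 ?_
          rw [pow_succ]
          have : 1 ≤ (d + 1) ^ n := Nat.one_le_pow _ _ (Nat.succ_pos _)
          nlinarith

theorem norm_bound (K : Type) [Field K] [NumberField K] (x : 𝓞 K) {R : ℝ}
    (hx : ∀ σ : K →+* ℂ, ‖σ (x : K)‖ ≤ R) :
    (Ideal.absNorm (Ideal.span {x}) : ℝ) ≤ R ^ Module.finrank ℚ K := by
  have e : (Ideal.absNorm (Ideal.span {x}) : ℝ) = ∏ σ : K →ₐ[ℚ] ℂ, ‖σ (x : K)‖ := by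
    rw [← norm_prod, ← Algebra.norm_eq_prod_embeddings ℚ ℂ (x : K), ← Algebra.coe_norm_int,
      Ideal.absNorm_span_singleton]
    simp [Nat.cast_natAbs]
  rw [e]
  refine (Finset.prod_le_prod (fun σ _ => norm_nonneg _) fun σ _ => hx σ.toRingHom).trans ?_
  rw [Finset.prod_const, Finset.card_univ, AlgHom.card]

theorem sum_mem_le (K : Type) [Field K] [NumberField K] (x : 𝓞 K) (hx : x ≠ 0) :
    (∑' p : PP K, open Classical in
      if x ∈ p.1 then ENNReal.ofReal (Real.log (Ideal.absNorm p.1)) else 0) ≤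
      ENNReal.ofReal (Real.log (Ideal.absNorm (Ideal.span {x}))) := by
  classical
  rw [mangoldt K (Ideal.span {x}) (by simpa using hx)]
  refine ENNReal.tsum_le_tsum fun p => ?_
  refine le_trans (le_of_eq ?_) (ENNReal.le_tsum 0)
  simp [Ideal.dvd_span_singleton]

theorem orbit_pigeon (K : Type) [Field K] [NumberField K] {N : ℕ}
    (Fp : Fin (N + 1) → MvPolynomial (Fin (N + 1)) (𝓞 K))
    (α : Fin (N + 1) → 𝓞 K) (p : PP K) :
    ∃ i j : ℕ, i < j ∧ j ≤ orbitLenK K Fp α p.1 ∧ ∀ a b : Fin (N + 1),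
      ((FmapK K Fp)^[i] α) a * ((FmapK K Fp)^[j] α) b -
        ((FmapK K Fp)^[i] α) b * ((FmapK K Fp)^[j] α) a ∈ p.1 := by
  classical
  have hfin : Finite ((𝓞 K) ⧸ p.1) := Ideal.finiteQuotientOfFreeOfNeBot p.1 p.2.2
  set f : ℕ → Quotient (MulAction.orbitRel ((𝓞 K) ⧸ p.1)ˣ (Fin (N + 1) → (𝓞 K) ⧸ p.1)) :=
    fun n : ℕ => Quotient.mk (MulAction.orbitRel ((𝓞 K) ⧸ p.1)ˣ (Fin (N + 1) → (𝓞 K) ⧸ p.1))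
      (fun i => Ideal.Quotient.mk p.1 (((FmapK K Fp)^[n] α) i)) with hf
  have hr : (Set.range f).Finite := Set.toFinite _
  have hcard : hr.toFinset.card = orbitLenK K Fp α p.1 := by
    rw [← Set.ncard_eq_toFinset_card]
    rfl
  obtain ⟨i, hi, j, hj, hne, hij⟩ := Finset.exists_ne_map_eq_of_card_lt_of_maps_to
    (s := Finset.range (orbitLenK K Fp α p.1 + 1)) (t := hr.toFinset) (f := f)
    (by rw [hcard, Finset.card_range]; omega) (fun n _ => by simp)
  have main : ∀ i j : ℕ, f i = f j → ∀ a b : Fin (N + 1),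
      ((FmapK K Fp)^[i] α) a * ((FmapK K Fp)^[j] α) b -
        ((FmapK K Fp)^[i] α) b * ((FmapK K Fp)^[j] α) a ∈ p.1 := by
    intro i j hij a b
    obtain ⟨u, hu⟩ := MulAction.orbitRel_apply.mp (Quotient.exact hij)
    have ha := congrFun hu a
    have hb := congrFun hu b
    simp only [Pi.smul_apply, Units.smul_def, smul_eq_mul] at ha hb
    rw [← Ideal.Quotient.eq_zero_iff_mem, map_sub, map_mul, map_mul, ← ha, ← hb]
    ring
  simp only [Finset.mem_range] at hi hj
  rcases lt_or_gt_of_ne hne with h | h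
  · exact ⟨i, j, h, by omega, main i j hij⟩
  · exact ⟨j, i, h, by omega, main j i hij.symm⟩

theorem growth_summable (d : ℕ) (A θ : ℝ) (hθ : 1 < θ) :
    Summable fun j : ℕ => (j : ℝ) * (A * ((d : ℝ) + 1) ^ j * Real.exp (-((j : ℝ) ^ θ))) := by
  set c : ℝ := Real.log (2 * ((d : ℝ) + 1))
  have hexp : ∀ j : ℕ, (2 * ((d : ℝ) + 1)) ^ j = Real.exp (c * j) := by
    intro j
    rw [← Real.rpow_natCast, Real.rpow_def_of_pos (by positivity)]
  refine Summable.of_norm_bounded_eventually_nat (g := fun j : ℕ => |A| * Real.exp (-(j : ℝ)))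
    (Real.summable_exp_neg_nat.mul_left _) ?_
  have h1 : Tendsto (fun j : ℕ => (j : ℝ) ^ (θ - 1)) atTop atTop :=
    (tendsto_rpow_atTop (by linarith)).comp tendsto_natCast_atTop_atTop
  filter_upwards [h1.eventually_ge_atTop (c + 1), eventually_gt_atTop 0] with j hj hj0
  have hj0' : (0 : ℝ) < j := by exact_mod_cast hj0
  have h2 : (j : ℝ) ^ θ = j ^ (θ - 1) * j := by
    rw [Real.rpow_sub_one hj0'.ne', div_mul_cancel₀ _ hj0'.ne']
  have h3 : (j : ℝ) ≤ 2 ^ j := by exact_mod_cast (Nat.lt_two_pow_self).le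
  rw [norm_mul, norm_mul, norm_mul, Real.norm_eq_abs A, Real.norm_of_nonneg hj0'.le,
    Real.norm_of_nonneg (by positivity), Real.norm_of_nonneg (Real.exp_pos _).le]
  calc (j : ℝ) * (|A| * ((d : ℝ) + 1) ^ j * Real.exp (-((j : ℝ) ^ θ)))
      ≤ 2 ^ j * (|A| * ((d : ℝ) + 1) ^ j * Real.exp (-((j : ℝ) ^ θ))) := by gcongr
    _ = |A| * (Real.exp (c * j) * Real.exp (-((j : ℝ) ^ θ))) := by
        rw [← hexp, mul_pow]; ring
    _ ≤ |A| * Real.exp (-(j : ℝ)) := by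
        rw [← Real.exp_add]
        refine mul_le_mul_of_nonneg_left (Real.exp_le_exp.mpr ?_) (abs_nonneg _)
        rw [h2]
        nlinarith

theorem bad_finite (K : Type) [Field K] [NumberField K] (N d : ℕ)
    (Fp : Fin (N + 1) → MvPolynomial (Fin (N + 1)) (𝓞 K))
    (hhom : ∀ i, (Fp i).IsHomogeneous d)
    (hzero : ∀ x : Fin (N + 1) → AlgebraicClosure K,
      (∀ i, MvPolynomial.aeval x ((Fp i).map (algebraMap (𝓞 K) K)) = 0) → x = 0)
    (α : Fin (N + 1) → 𝓞 K) (hα : α ≠ 0)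
    (horbit : ∀ m n : ℕ, m < n → ∃ i j : Fin (N + 1),
      ((FmapK K Fp)^[m] α) i * ((FmapK K Fp)^[n] α) j ≠
        ((FmapK K Fp)^[m] α) j * ((FmapK K Fp)^[n] α) i)
    (γ : ℝ) (hγ0 : 0 < γ) (hγ1 : γ < 1) :
    (∑' p : PP K, open Classical in
      if GoodIdeal K Fp α p.1 ∧
            Real.log (Ideal.absNorm p.1) ^ γ ≤ (orbitLenK K Fp α p.1 : ℝ) then 0
      else ENNReal.ofReal (Real.log (Ideal.absNorm p.1) * (Ideal.absNorm p.1 : ℝ) ^ (-1 : ℝ)))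
      ≠ ⊤ := by
  classical
  obtain ⟨D, hD0, hD⟩ := good_of K Fp hzero α hα
  obtain ⟨B, hB2, hB⟩ := iter_bound K Fp hhom α
  choose a b hab using horbit
  let x : (j : ℕ) → Fin j → 𝓞 K := fun j i =>
    ((FmapK K Fp)^[i] α) (a i j i.2) * ((FmapK K Fp)^[j] α) (b i j i.2) -
        ((FmapK K Fp)^[i] α) (b i j i.2) * ((FmapK K Fp)^[j] α) (a i j i.2)
  have hx0 : ∀ j i, x j i ≠ 0 := fun j i => sub_ne_zero.mpr (hab i j i.2)
  have hxb : ∀ j i (σ : K →+* ℂ), ‖σ (x j i : K)‖ ≤ B ^ (3 * (d + 1) ^ j) := by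
    intro j i σ
    have hij : (d + 1) ^ (i : ℕ) ≤ (d + 1) ^ j := Nat.pow_le_pow_right (Nat.succ_pos _) i.2.le
    have h1 : 1 ≤ (d + 1) ^ j := Nat.one_le_pow _ _ (Nat.succ_pos _)
    have hm : ∀ u v, ‖σ ((((FmapK K Fp)^[i] α u : 𝓞 K) : K) * (((FmapK K Fp)^[j] α v : 𝓞 K) : K))‖
        ≤ B ^ (2 * (d + 1) ^ j) := by
      intro u v
      rw [map_mul, norm_mul, two_mul, pow_add]
      refine mul_le_mul ((hB i σ u).trans (pow_le_pow_right₀ (by linarith) hij)) (hB j σ v)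
        (norm_nonneg _) (by positivity)
    have e : σ (x j i : K) =
        σ ((((FmapK K Fp)^[i] α (a i j i.2) : 𝓞 K) : K) *
          (((FmapK K Fp)^[j] α (b i j i.2) : 𝓞 K) : K)) -
        σ ((((FmapK K Fp)^[i] α (b i j i.2) : 𝓞 K) : K) *
          (((FmapK K Fp)^[j] α (a i j i.2) : 𝓞 K) : K)) := by
      rw [← map_sub]; congr 1
    rw [e]
    refine (norm_sub_le _ _).trans ((add_le_add (hm _ _) (hm _ _)).trans ?_)
    calc B ^ (2 * (d + 1) ^ j) + B ^ (2 * (d + 1) ^ j) = 2 * B ^ (2 * (d + 1) ^ j) := by ring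
      _ ≤ B * B ^ (2 * (d + 1) ^ j) := by gcongr
      _ = B ^ (1 + 2 * (d + 1) ^ j) := by rw [pow_add, pow_one]
      _ ≤ _ := pow_le_pow_right₀ (by linarith) (by omega)
  set A : ℝ := 3 * Module.finrank ℚ K * Real.log B with hA
  have hxN : ∀ j i, Real.log (Ideal.absNorm (Ideal.span {x j i})) ≤ A * ((d : ℝ) + 1) ^ j := by
    intro j i
    have h1 := norm_bound K (x j i) (hxb j i)
    have h2 : (0 : ℝ) < Ideal.absNorm (Ideal.span {x j i}) :=
      zero_lt_one.trans_le (norm_ge_one K ⟨Ideal.span {x j i}, by simpa using hx0 j i⟩)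
    refine (Real.log_le_log h2 h1).trans (le_of_eq ?_)
    rw [Real.log_pow, Real.log_pow, hA]
    push_cast
    ring
  set θ : ℝ := 1 / γ with hθdef
  have hθ : 1 < θ := by rw [hθdef, lt_div_iff₀ hγ0]; linarith
  have hgs := growth_summable d A θ hθ
  let lg : PP K → ENNReal := fun p => ENNReal.ofReal (Real.log (Ideal.absNorm p.1))
  let E : ℕ → ENNReal := fun j => ENNReal.ofReal (Real.exp (-((j : ℝ) ^ θ)))
  have hterm : ∀ p : PP K, (if GoodIdeal K Fp α p.1 ∧
            Real.log (Ideal.absNorm p.1) ^ γ ≤ (orbitLenK K Fp α p.1 : ℝ) then 0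
      else ENNReal.ofReal (Real.log (Ideal.absNorm p.1) * (Ideal.absNorm p.1 : ℝ) ^ (-1 : ℝ)))
      ≤ (if D ∈ p.1 then lg p else 0) + ∑' j : ℕ, ∑' i : Fin j,
        (if x j i ∈ p.1 then lg p else 0) * E j := by
    intro p
    have hN2 := norm_ge_two K p
    have hlog := log_norm_nonneg K p.1
    split_ifs with hg hDp hDp
    · exact zero_le
    · exact zero_le
    · refine le_add_right (ENNReal.ofReal_le_ofReal ?_)
      refine mul_le_of_le_one_right hlog ?_
      exact Real.rpow_le_one_of_one_le_of_nonpos (by linarith) (by norm_num)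
    · have hgood := hD p.1 p.2.1 p.2.2 hDp
      have hlt : (orbitLenK K Fp α p.1 : ℝ) < Real.log (Ideal.absNorm p.1) ^ γ := by
        by_contra hcon
        exact hg ⟨hgood, not_lt.mp hcon⟩
      obtain ⟨i, j, hij, hjm, hmem⟩ := orbit_pigeon K Fp α p
      rw [zero_add]
      refine le_trans ?_ (ENNReal.le_tsum j)
      refine le_trans ?_ (ENNReal.le_tsum (⟨i, hij⟩ : Fin j))
      have hxm : x j ⟨i, hij⟩ ∈ p.1 := hmem _ _
      rw [if_pos hxm, ENNReal.ofReal_mul hlog]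
      refine mul_le_mul_right (ENNReal.ofReal_le_ofReal ?_) _
      have hj : (j : ℝ) ≤ Real.log (Ideal.absNorm p.1) ^ γ :=
        le_trans (by exact_mod_cast hjm) hlt.le
      have hj2 : (j : ℝ) ^ θ ≤ Real.log (Ideal.absNorm p.1) := by
        have := Real.rpow_le_rpow (by positivity) hj (by positivity : 0 ≤ θ)
        rwa [← Real.rpow_mul hlog, hθdef, mul_one_div_cancel hγ0.ne', Real.rpow_one] at this
      rw [Real.rpow_def_of_pos (by linarith)]
      exact Real.exp_le_exp.mpr (by linarith)
  refine ne_top_of_le_ne_top ?_ (ENNReal.tsum_le_tsum hterm)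
  rw [ENNReal.tsum_add, ENNReal.tsum_comm]
  refine ENNReal.add_ne_top.mpr ⟨?_, ?_⟩
  · exact ne_top_of_le_ne_top ENNReal.ofReal_ne_top (sum_mem_le K D hD0)
  · refine ne_top_of_le_ne_top hgs.tsum_ofReal_ne_top (ENNReal.tsum_le_tsum fun j => ?_)
    rw [ENNReal.tsum_comm, tsum_fintype]
    calc _ ≤ ∑ i : Fin j, ENNReal.ofReal (A * ((d : ℝ) + 1) ^ j) * E j := by
          refine Finset.sum_le_sum fun i _ => ?_
          rw [ENNReal.tsum_mul_right]
          refine mul_le_mul_left ?_ _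
          exact (sum_mem_le K (x j i) (hx0 j i)).trans (ENNReal.ofReal_le_ofReal (hxN j i))
      _ = _ := by
          have hA0 : 0 ≤ A := by
            have := Real.log_nonneg (show 1 ≤ B by linarith)
            positivity
          rw [Finset.sum_const, Finset.card_univ, Fintype.card_fin, nsmul_eq_mul,
            ENNReal.ofReal_mul (p := (j : ℝ)) (by positivity), ENNReal.ofReal_natCast,
            ENNReal.ofReal_mul (p := A * ((d : ℝ) + 1) ^ j) (by positivity)]

theorem stmt2 (K : Type) [Field K] [NumberField K] (N d : ℕ) (hN : 1 ≤ N) (hd : 2 ≤ d)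
    (Fp : Fin (N + 1) → MvPolynomial (Fin (N + 1)) (𝓞 K))
    (hhom : ∀ i, (Fp i).IsHomogeneous d)
    (hzero : ∀ x : Fin (N + 1) → AlgebraicClosure K,
      (∀ i, MvPolynomial.aeval x ((Fp i).map (algebraMap (𝓞 K) K)) = 0) → x = 0)
    (α : Fin (N + 1) → 𝓞 K) (hα : α ≠ 0)
    (horbit : ∀ m n : ℕ, m < n → ∃ i j : Fin (N + 1),
      ((FmapK K Fp)^[m] α) i * ((FmapK K Fp)^[n] α) j ≠
        ((FmapK K Fp)^[m] α) j * ((FmapK K Fp)^[n] α) i)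
    (γ : ℝ) (hγ0 : 0 < γ) (hγ1 : γ < 1) :
    Tendsto (fun s : ℝ => (s - 1) *
        ∑' p : {p : Ideal (𝓞 K) // GoodIdeal K Fp α p ∧
            Real.log (Ideal.absNorm p) ^ γ ≤ (orbitLenK K Fp α p : ℝ)},
          Real.log (Ideal.absNorm p.1) / (Ideal.absNorm p.1 : ℝ) ^ s)
      (𝓝[>] (1 : ℝ)) (𝓝 1) := by
  classical
  have hbad := bad_finite K N d Fp hhom hzero α hα horbit γ hγ0 hγ1
  set S : Set (PP K) := {p | GoodIdeal K Fp α p.1 ∧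
            Real.log (Ideal.absNorm p.1) ^ γ ≤ (orbitLenK K Fp α p.1 : ℝ)} with hS
  let f : ℝ → PP K → ℝ := fun s p =>
    Real.log (Ideal.absNorm p.1) * (Ideal.absNorm p.1 : ℝ) ^ (-s)
  have hf0 : ∀ s p, 0 ≤ f s p := fun s p => mul_nonneg (log_norm_nonneg K _) (by positivity)
  have hfs : ∀ s : ℝ, 1 < s → Summable (f s) := fun s hs => PP_summable K hs
  set C : ENNReal := ∑' p : PP K, ENNReal.ofReal (Sᶜ.indicator (f 1) p) with hC
  have hCt : C ≠ ⊤ := by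
    refine ne_top_of_le_ne_top hbad (ENNReal.tsum_le_tsum fun p => ?_)
    by_cases hp : p ∈ S
    · rw [Set.indicator_of_notMem (by simpa using hp)]
      simp
    · have hp' : ¬ (GoodIdeal K Fp α p.1 ∧
          Real.log (Ideal.absNorm p.1) ^ γ ≤ (orbitLenK K Fp α p.1 : ℝ)) := hp
      rw [Set.indicator_of_mem (by simpa using hp), if_neg hp']
  have hle : ∀ s : ℝ, 1 < s → ∑' p, Sᶜ.indicator (f s) p ≤ C.toReal := by
    intro s hs
    rw [← ENNReal.ofReal_le_iff_le_toReal hCt, ENNReal.ofReal_tsum_of_nonneg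
      (fun p => Set.indicator_nonneg (fun p _ => hf0 s p) p) ((hfs s hs).indicator _)]
    refine ENNReal.tsum_le_tsum fun p => ENNReal.ofReal_le_ofReal ?_
    refine Set.indicator_le_indicator ?_
    refine mul_le_mul_of_nonneg_left ?_ (log_norm_nonneg K _)
    exact Real.rpow_le_rpow_of_exponent_le (by linarith [norm_ge_two K p]) (by linarith)
  have hbad0 : Tendsto (fun s : ℝ => (s - 1) * ∑' p, Sᶜ.indicator (f s) p) (𝓝[>] 1) (𝓝 0) := by
    have hs1 : Tendsto (fun s : ℝ => (s - 1) * C.toReal) (𝓝[>] 1) (𝓝 0) := by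
      have : Tendsto (fun s : ℝ => (s - 1) * C.toReal) (𝓝 1) (𝓝 ((1 - 1) * C.toReal)) :=
        ContinuousAt.tendsto (by fun_prop)
      rw [sub_self, zero_mul] at this
      exact this.mono_left nhdsWithin_le_nhds
    refine tendsto_of_tendsto_of_tendsto_of_le_of_le' tendsto_const_nhds hs1 ?_ ?_
    · filter_upwards [self_mem_nhdsWithin] with s hs
      have hs : 1 < s := hs
      exact mul_nonneg (by linarith)
        (tsum_nonneg fun p => Set.indicator_nonneg (fun p _ => hf0 s p) p)
    · filter_upwards [self_mem_nhdsWithin] with s hs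
      have hs : 1 < s := hs
      exact mul_le_mul_of_nonneg_left (hle s hs) (by linarith)
  have h := (primes_tendsto K).sub hbad0
  rw [sub_zero] at h
  refine h.congr' ?_
  filter_upwards [self_mem_nhdsWithin] with s hs
  have hs : 1 < s := hs
  have hsplit : ∑' p, f s p = ∑' p, S.indicator (f s) p + ∑' p, Sᶜ.indicator (f s) p := by
    rw [← ((hfs s hs).indicator S).tsum_add ((hfs s hs).indicator Sᶜ)]
    refine tsum_congr fun p => ?_
    exact (congrFun (Set.indicator_self_add_compl S (f s)) p).symm
  have hre : ∑' p : {p : Ideal (𝓞 K) // GoodIdeal K Fp α p ∧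
            Real.log (Ideal.absNorm p) ^ γ ≤ (orbitLenK K Fp α p : ℝ)},
          Real.log (Ideal.absNorm p.1) / (Ideal.absNorm p.1 : ℝ) ^ s =
      ∑' p, S.indicator (f s) p := by
    let g : {p : Ideal (𝓞 K) // GoodIdeal K Fp α p ∧
            Real.log (Ideal.absNorm p) ^ γ ≤ (orbitLenK K Fp α p : ℝ)} → PP K :=
      fun p => ⟨p.1, p.2.1.1, p.2.1.2.1⟩
    have hg : Function.Injective g := by
      intro p q hpq
      have h2 := congrArg (fun I : PP K => I.1) hpq
      exact Subtype.ext h2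
    rw [← hg.tsum_eq (f := S.indicator (f s))]
    · refine tsum_congr fun p => ?_
      have hp : g p ∈ S := p.2
      rw [Set.indicator_of_mem hp]
      simp only [f, g]
      rw [Real.rpow_neg (by positivity), div_eq_mul_inv]
    · intro p hp
      have hp : p ∈ S := Set.mem_of_indicator_ne_zero hp
      exact ⟨⟨p.1, hp⟩, rfl⟩
  rw [hre]
  change (s - 1) * (∑' p, f s p) - _ = _
  rw [hsplit]
  ring
end
end
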